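/- arXiv:2310.13750 — 3 statements merged into one kernel-verified Lean document; each statement's English description precedes it below -/
import Mathlib

section
/- Let 0 ≤ β ≤ α < ∞, 0 < q < ∞ and 1 < r ≤ ∞, with α > 1/q and β = 1/q − 1/(2r′). If there exists C > 0 such that ‖R*_{α,β}F‖_{L^q(ℝ²)} ≤ C · ‖F‖_{L^r(S¹)} for all measurable F : ℝ → ℂ, then q ≥ r. -/
open MeasureTheory Real Set Filter
open scoped ENNReal

noncomputable section

/-- Fourier extension operator of the unit circle,
`(R*F)(x,y) = (1/(2π)) ∫_0^{2π} F(φ) exp(i(x cos φ + y sin φ)) dφ`. -/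
def Rext (F : ℝ → ℂ) (x y : ℝ) : ℂ :=
  Complex.ofReal (1 / (2 * π)) *
    ∫ φ in (0:ℝ)..(2 * π),
      F φ * Complex.exp (Complex.I * Complex.ofReal (x * Real.cos φ + y * Real.sin φ))

/-- Weighted extension operator with product weight `(1+|x|)^{-α}(1+|y|)^{-β}`. -/
def Rab (α β : ℝ) (F : ℝ → ℂ) (x y : ℝ) : ℂ :=
  Rext F x y * Complex.ofReal ((1 + |x|) ^ (-α) * (1 + |y|) ^ (-β))

/-- Weighted extension operator with weight `(1+|x|+|y|)^{-γ}`. -/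
def Rgamma (γ : ℝ) (F : ℝ → ℂ) (x y : ℝ) : ℂ :=
  Rext F x y * Complex.ofReal ((1 + |x| + |y|) ^ (-γ))

/-- `L^r` norm on the circle, parametrized by `[0, 2π]`. -/
def circleLp (r : ℝ≥0∞) (F : ℝ → ℂ) : ℝ≥0∞ :=
  eLpNorm F r (volume.restrict (Ioc (0:ℝ) (2 * π)))

/-- `L^q` quasinorm on the plane. -/
def planeLp (q : ℝ≥0∞) (g : ℝ × ℝ → ℂ) : ℝ≥0∞ :=
  eLpNorm g q (volume : Measure (ℝ × ℝ))

/-- Weak `L^q` quasinorm on the line. -/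
def wline (q : ℝ) (g : ℝ → ℂ) : ℝ≥0∞ :=
  ⨆ (t : ℝ) (_ : 0 < t), ENNReal.ofReal t * (volume {x : ℝ | t < ‖g x‖}) ^ (1 / q)

/-- Weak `L^q` quasinorm on the line, for `ℝ≥0∞`-valued functions. -/
def wlineE (q : ℝ) (g : ℝ → ℝ≥0∞) : ℝ≥0∞ :=
  ⨆ (t : ℝ) (_ : 0 < t), ENNReal.ofReal t * (volume {x : ℝ | ENNReal.ofReal t < g x}) ^ (1 / q)

/-- Mixed weak quasinorm `L^{q,∞}_x(L^{q,∞}_y)`. -/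
def mixedXY (q : ℝ) (g : ℝ × ℝ → ℂ) : ℝ≥0∞ :=
  wlineE q fun x => wline q fun y => g (x, y)

/-- Mixed weak quasinorm `L^{q,∞}_y(L^{q,∞}_x)`. -/
def mixedYX (q : ℝ) (g : ℝ × ℝ → ℂ) : ℝ≥0∞ :=
  wlineE q fun y => wline q fun x => g (x, y)

/-- Weak `L^q` quasinorm on the plane. -/
def wplane (q : ℝ) (g : ℝ × ℝ → ℂ) : ℝ≥0∞ :=
  ⨆ (t : ℝ) (_ : 0 < t), ENNReal.ofReal t * (volume {p : ℝ × ℝ | t < ‖g p‖}) ^ (1 / q)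

/-- Lorentz `L^{r,1}` norm on the circle. -/
def lorentz1 (r : ℝ) (F : ℝ → ℂ) : ℝ≥0∞ :=
  ∫⁻ t in Ioi (0:ℝ), (volume {φ ∈ Icc (0:ℝ) (2 * π) | t < ‖F φ‖}) ^ (1 / r)

/-- Weak `L^r` quasinorm on the circle. -/
def wcircle (r : ℝ) (F : ℝ → ℂ) : ℝ≥0∞ :=
  ⨆ (t : ℝ) (_ : 0 < t), ENNReal.ofReal t * (volume {φ ∈ Icc (0:ℝ) (2 * π) | t < ‖F φ‖}) ^ (1 / r)

lemma aux_tail (a x y T : ℝ) (ha : 0 ≤ a) (hx0 : 0 ≤ x) (hx1 : x ≤ 1) (hy : 0 < y)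
    (hT0 : 0 < T) (hT1 : T ≤ 1) :
    -(sin T ^ (-a-1) * cos (x * sin T) * ((1 - cos (y * (1 - cos T))) / y)) ≤
    ∫ θ in T..(π/2), (sin θ ^ (-a-1) * cos (x * sin θ)) * (sin (y * (1 - cos θ)) * sin θ) := by
  have hpi := Real.pi_gt_three
  have hTp : T ≤ π/2 := by linarith
  have hs : ∀ θ ∈ uIcc T (π/2), 0 < sin θ := by
    intro θ hθ
    rw [uIcc_of_le hTp] at hθ
    exact sin_pos_of_pos_of_lt_pi (by linarith [hθ.1]) (by linarith [hθ.2])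
  have hc : ∀ θ ∈ uIcc T (π/2), 0 ≤ cos θ := by
    intro θ hθ
    rw [uIcc_of_le hTp] at hθ
    exact cos_nonneg_of_neg_pi_div_two_le_of_le (by linarith [hθ.1]) (by linarith [hθ.2])
  have hxs : ∀ θ ∈ uIcc T (π/2), 0 ≤ x * sin θ ∧ x * sin θ ≤ 1 := by
    intro θ hθ
    have := hs θ hθ
    have h1 := sin_le_one θ
    exact ⟨by positivity, by nlinarith⟩
  set u' : ℝ → ℝ := fun θ => (cos θ * (-a-1) * sin θ ^ (-a-1-1)) * cos (x * sin θ) +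
      sin θ ^ (-a-1) * (-sin (x * sin θ) * (x * cos θ)) with hu'
  have hu : ∀ θ ∈ uIcc T (π/2), HasDerivAt (fun θ => sin θ ^ (-a-1) * cos (x * sin θ)) (u' θ) θ := by
    intro θ hθ
    exact ((hasDerivAt_sin θ).rpow_const (Or.inl (hs θ hθ).ne')).mul
      (((hasDerivAt_sin θ).const_mul x).cos)
  have hv : ∀ θ ∈ uIcc T (π/2), HasDerivAt (fun θ => (1 - cos (y * (1 - cos θ))) / y)
      (sin (y * (1 - cos θ)) * sin θ) θ := by
    intro θ hθ
    have := (((((hasDerivAt_cos θ).const_sub 1).const_mul y).cos).const_sub 1).div_const y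
    refine this.congr_deriv ?_
    field_simp
  have hcu : ContinuousOn u' (uIcc T (π/2)) := by
    intro θ hθ
    have h := (hs θ hθ).ne'
    apply ContinuousAt.continuousWithinAt
    have c1 : ContinuousAt (fun θ => sin θ ^ (-a-1-1)) θ :=
      ContinuousAt.rpow_const (f := sin) continuous_sin.continuousAt (Or.inl h)
    have c2 : ContinuousAt (fun θ => sin θ ^ (-a-1)) θ :=
      ContinuousAt.rpow_const (f := sin) continuous_sin.continuousAt (Or.inl h)
    have d1 : Continuous fun θ => cos θ * (-a-1) := by fun_prop
    have d2 : Continuous fun θ => cos (x * sin θ) := by fun_prop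
    have d3 : Continuous fun θ => -sin (x * sin θ) * (x * cos θ) := by fun_prop
    exact ((d1.continuousAt.mul c1).mul d2.continuousAt).add (c2.mul d3.continuousAt)
  have key := intervalIntegral.integral_mul_deriv_eq_deriv_mul hu hv hcu.intervalIntegrable
    ((by fun_prop : Continuous fun θ => sin (y * (1 - cos θ)) * sin θ).intervalIntegrable _ _)
  rw [key]
  have h1 : 0 ≤ sin (π/2) ^ (-a-1) * cos (x * sin (π/2)) * ((1 - cos (y * (1 - cos (π/2)))) / y) := by
    have h2 := cos_le_one (y * (1 - cos (π/2)))
    have h3 : 0 ≤ cos (x * sin (π/2)) := by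
      rw [sin_pi_div_two]
      exact cos_nonneg_of_neg_pi_div_two_le_of_le (by linarith) (by linarith)
    have h4 : 0 ≤ (1 - cos (y * (1 - cos (π/2)))) / y := div_nonneg (by linarith) hy.le
    have h5 : 0 ≤ sin (π/2) ^ (-a-1) := by rw [sin_pi_div_two]; positivity
    positivity
  have h2 : ∫ θ in T..(π/2), u' θ * ((1 - cos (y * (1 - cos θ))) / y) ≤ 0 := by
    have : 0 ≤ ∫ θ in T..(π/2), -(u' θ * ((1 - cos (y * (1 - cos θ))) / y)) := by
      apply intervalIntegral.integral_nonneg hTp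
      intro θ hθ
      rw [← uIcc_of_le hTp] at hθ
      have hs1 := hs θ hθ
      have hc1 := hc θ hθ
      have hx2 := hxs θ hθ
      have h3 : 0 ≤ cos (x * sin θ) :=
        cos_nonneg_of_neg_pi_div_two_le_of_le (by linarith) (by linarith)
      have h4 : 0 ≤ sin (x * sin θ) := sin_nonneg_of_nonneg_of_le_pi hx2.1 (by linarith)
      have h5 : 0 ≤ (1 - cos (y * (1 - cos θ))) / y :=
        div_nonneg (by linarith [cos_le_one (y * (1 - cos θ))]) hy.le
      have : -(u' θ * ((1 - cos (y * (1 - cos θ))) / y)) =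
        ((cos θ * (a+1) * sin θ ^ (-a-1-1)) * cos (x * sin θ) +
      sin θ ^ (-a-1) * (sin (x * sin θ) * (x * cos θ))) * ((1 - cos (y * (1 - cos θ))) / y) := by
        simp only [hu']; ring
      rw [this]
      positivity
    rw [intervalIntegral.integral_neg] at this
    linarith
  linarith

lemma aux_head (a x y T ε : ℝ) (ha : 0 ≤ a) (hx0 : 0 ≤ x) (hx1 : x ≤ 1)
    (hT0 : 0 < T) (hT1 : T ≤ 1) (hy : y = 1 / T^2) (hε : 0 < ε) (hεT : ε ≤ sin T) :
    T ^ (1 - a) / 6144 ≤ (∫ θ in (0:ℝ)..T, (max (sin θ) ε) ^ (-a) * cos (x * sin θ) *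
      sin (y * (1 - cos θ))) - sin T ^ (-a-1) * cos (x * sin T) * ((1 - cos (y * (1 - cos T))) / y) := by
  have hpi := Real.pi_gt_three
  have hpi4 := Real.pi_lt_four
  have hy0 : 0 < y := by rw [hy]; positivity
  have hsT : 0 < sin T := by linarith
  set f : ℝ → ℝ := fun θ => (max (sin θ) ε) ^ (-a) * cos (x * sin θ) * sin (y * (1 - cos θ)) with hf
  set g : ℝ → ℝ := fun θ => sin T ^ (-a-1) * cos (x * sin T) * (sin (y * (1 - cos θ)) * sin θ) with hg
  have hfc : Continuous f := by
    have : Continuous fun θ => (max (sin θ) ε) ^ (-a) := by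
      refine Continuous.rpow_const (by fun_prop) fun θ => Or.inl ?_
      have := le_max_right (sin θ) ε
      linarith
    simp only [hf]; fun_prop
  have hgc : Continuous g := by simp only [hg]; fun_prop
  have hgi : ∫ θ in (0:ℝ)..T, g θ =
      sin T ^ (-a-1) * cos (x * sin T) * ((1 - cos (y * (1 - cos T))) / y) := by
    simp only [hg]
    rw [intervalIntegral.integral_const_mul]
    congr 1
    have hv : ∀ θ ∈ uIcc 0 T, HasDerivAt (fun θ => (1 - cos (y * (1 - cos θ))) / y)
      (sin (y * (1 - cos θ)) * sin θ) θ := by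
      intro θ hθ
      have := (((((hasDerivAt_cos θ).const_sub 1).const_mul y).cos).const_sub 1).div_const y
      refine this.congr_deriv ?_
      field_simp
    rw [intervalIntegral.integral_eq_sub_of_hasDerivAt hv
      ((by fun_prop : Continuous fun θ => sin (y * (1 - cos θ)) * sin θ).intervalIntegrable _ _)]
    simp
  rw [← hgi, ← intervalIntegral.integral_sub (hfc.intervalIntegrable _ _) (hgc.intervalIntegrable _ _)]
  have hcT : 1/2 ≤ cos (x * sin T) := by
    have h1 := sin_le_one T
    have h2 : 0 ≤ x * sin T := by positivity
    have h3 : x * sin T ≤ 1 := by nlinarith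
    have := one_sub_sq_div_two_le_cos (x := x * sin T)
    nlinarith
  have hlow : ∀ θ, 0 ≤ θ → θ ≤ T → 0 ≤ sin (y * (1 - cos θ)) ∧ 0 ≤ 1 - sin θ / sin T ∧
      sin (y * (1 - cos θ)) * (sin T ^ (-a) * cos (x * sin T) * (1 - sin θ / sin T)) ≤ f θ - g θ := by
    intro θ h0 h1
    have hsθ : 0 ≤ sin θ := sin_nonneg_of_nonneg_of_le_pi h0 (by linarith)
    have hsm : sin θ ≤ sin T := sin_le_sin_of_le_of_le_pi_div_two (by linarith) (by linarith) h1
    have hv0 : 0 ≤ y * (1 - cos θ) := mul_nonneg hy0.le (by linarith [cos_le_one θ])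
    have hv1 : y * (1 - cos θ) ≤ 1 := by
      have := one_sub_sq_div_two_le_cos (x := θ)
      calc y * (1 - cos θ) ≤ y * T^2 := by
            apply mul_le_mul_of_nonneg_left _ hy0.le; nlinarith
        _ = 1 := by rw [hy]; field_simp
    have hsv : 0 ≤ sin (y * (1 - cos θ)) := sin_nonneg_of_nonneg_of_le_pi hv0 (by linarith)
    refine ⟨hsv, by rw [sub_nonneg, div_le_one hsT]; exact hsm, ?_⟩
    have hm : sin T ^ (-a) ≤ (max (sin θ) ε) ^ (-a) :=
      rpow_le_rpow_of_nonpos (by positivity) (max_le hsm hεT) (by linarith)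
    have hcm : cos (x * sin T) ≤ cos (x * sin θ) := by
      apply cos_le_cos_of_nonneg_of_le_pi (by positivity)
      · nlinarith [sin_le_one T]
      · exact mul_le_mul_of_nonneg_left hsm hx0
    have e : sin T ^ (-a-1) = sin T ^ (-a) / sin T := rpow_sub_one hsT.ne' _
    have : sin T ^ (-a) * cos (x * sin T) ≤ (max (sin θ) ε) ^ (-a) * cos (x * sin θ) :=
      mul_le_mul hm hcm (by linarith) (by positivity)
    have h6 := mul_le_mul_of_nonneg_right this hsv
    simp only [hf, hg, e]
    have : sin T ^ (-a) / sin T * cos (x * sin T) * (sin (y * (1 - cos θ)) * sin θ) =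
      sin (y * (1 - cos θ)) * (sin T ^ (-a) * cos (x * sin T) * (sin θ / sin T)) := by
      field_simp
    rw [this]
    linarith
  have hnn : ∀ θ, 0 ≤ θ → θ ≤ T → 0 ≤ f θ - g θ := by
    intro θ h0 h1
    obtain ⟨p, p2, p3⟩ := hlow θ h0 h1
    refine le_trans ?_ p3
    positivity
  have hmid : ∀ θ ∈ Icc (T/4) (T/2), T ^ (-a) / 1536 ≤ f θ - g θ := by
    intro θ hθ
    obtain ⟨p, p2, p3⟩ := hlow θ (by linarith [hθ.1]) (by linarith [hθ.2])
    refine le_trans ?_ p3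
    have q1 : 1/256 ≤ sin (y * (1 - cos θ)) := by
      have c1 : cos θ ≤ 1 - 2 / π^2 * θ^2 := cos_le_one_sub_mul_cos_sq (by rw [abs_of_nonneg] <;> linarith [hθ.1, hθ.2])
      have c2 : 1/8 ≤ 2 / π^2 := by rw [div_le_div_iff₀] <;> nlinarith
      have c3 : T^2/128 ≤ 1 - cos θ := by
        have : (T/4)^2 ≤ θ^2 := by apply pow_le_pow_left₀ (by positivity) hθ.1
        nlinarith
      have c4 : 1/128 ≤ y * (1 - cos θ) := by
        calc (1/128 : ℝ) = y * (T^2/128) := by rw [hy]; field_simp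
          _ ≤ _ := mul_le_mul_of_nonneg_left c3 hy0.le
      have c5 : y * (1 - cos θ) ≤ 1 := by
        have := one_sub_sq_div_two_le_cos (x := θ)
        calc y * (1 - cos θ) ≤ y * T^2 := by
              apply mul_le_mul_of_nonneg_left _ hy0.le; nlinarith [hθ.1, hθ.2]
          _ = 1 := by rw [hy]; field_simp
      have c6 := mul_le_sin (x := y * (1 - cos θ)) (by linarith) (by linarith)
      have c7 : 1/2 ≤ 2/π := by rw [div_le_div_iff₀] <;> linarith
      nlinarith
    have q2 : 1/3 ≤ 1 - sin θ / sin T := by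
      have c1 : sin θ ≤ T/2 := (sin_le (by linarith [hθ.1])).trans hθ.2
      have c2 := sin_gt_sub_cube hT0
      have c3 : 3/4*T ≤ sin T := by
        have : T^3 ≤ T := by nlinarith [mul_pos hT0 hT0]
        linarith
      have : sin θ / sin T ≤ 2/3 := by rw [div_le_iff₀ hsT]; linarith
      linarith
    have q3 : T ^ (-a) ≤ sin T ^ (-a) :=
      rpow_le_rpow_of_nonpos hsT (sin_le hT0.le) (by linarith)
    have hTa : 0 < T ^ (-a) := rpow_pos_of_pos hT0 _
    calc T ^ (-a) / 1536 = 1/256 * (T ^ (-a) * (1/2) * (1/3)) := by ring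
      _ ≤ _ := by gcongr
  have hI : ∀ p q, IntervalIntegrable (fun θ => f θ - g θ) volume p q :=
    fun p q => (hfc.sub hgc).intervalIntegrable _ _
  rw [← intervalIntegral.integral_add_adjacent_intervals (hI 0 (T/4)) (hI (T/4) T),
    ← intervalIntegral.integral_add_adjacent_intervals (hI (T/4) (T/2)) (hI (T/2) T)]
  have i1 : 0 ≤ ∫ θ in (0:ℝ)..(T/4), f θ - g θ :=
    intervalIntegral.integral_nonneg (by linarith) fun θ h => hnn θ h.1 (by linarith [h.2])
  have i3 : 0 ≤ ∫ θ in (T/2)..T, f θ - g θ :=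
    intervalIntegral.integral_nonneg (by linarith) fun θ h => hnn θ (by linarith [h.1]) h.2
  have i2 : ∫ θ in (T/4)..(T/2), T ^ (-a) / 1536 ≤ ∫ θ in (T/4)..(T/2), f θ - g θ :=
    intervalIntegral.integral_mono_on (by linarith) (by simp) (hI _ _) hmid
  rw [intervalIntegral.integral_const, smul_eq_mul] at i2
  have e : T ^ (1 - a) = T * T ^ (-a) := by
    rw [show (1:ℝ) - a = -a + 1 by ring, rpow_add_one hT0.ne', mul_comm]
  rw [e]
  linarith

lemma aux_real (a x y T ε : ℝ) (ha : 0 ≤ a) (hx0 : 0 ≤ x) (hx1 : x ≤ 1)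
    (hT0 : 0 < T) (hT1 : T ≤ 1) (hy : y = 1 / T^2) (hε : 0 < ε) (hεT : ε ≤ sin T) :
    T ^ (1 - a) / 6144 ≤ ∫ θ in (0:ℝ)..(π/2), (max (sin θ) ε) ^ (-a) * cos (x * sin θ) *
      sin (y * (1 - cos θ)) := by
  have hpi := Real.pi_gt_three
  have hfc : Continuous fun θ => (max (sin θ) ε) ^ (-a) * cos (x * sin θ) * sin (y * (1 - cos θ)) := by
    have : Continuous fun θ => (max (sin θ) ε) ^ (-a) := by
      refine Continuous.rpow_const (by fun_prop) fun θ => Or.inl ?_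
      have := le_max_right (sin θ) ε
      linarith
    fun_prop
  rw [← intervalIntegral.integral_add_adjacent_intervals (hfc.intervalIntegrable 0 T)
    (hfc.intervalIntegrable T _)]
  have h1 := aux_head a x y T ε ha hx0 hx1 hT0 hT1 hy hε hεT
  have h2 := aux_tail a x y T ha hx0 hx1 (by rw [hy]; positivity) hT0 hT1
  have h3 : ∫ θ in T..(π/2), (sin θ ^ (-a-1) * cos (x * sin θ)) * (sin (y * (1 - cos θ)) * sin θ)
    = ∫ θ in T..(π/2), (max (sin θ) ε) ^ (-a) * cos (x * sin θ) * sin (y * (1 - cos θ)) := by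
    apply intervalIntegral.integral_congr
    intro θ hθ
    rw [uIcc_of_le (by linarith)] at hθ
    have hsm : sin T ≤ sin θ := sin_le_sin_of_le_of_le_pi_div_two (by linarith) hθ.2 hθ.1
    have hs : 0 < sin θ := by linarith
    simp only
    rw [max_eq_left (by linarith), rpow_sub_one hs.ne']
    field_simp
  rw [h3] at h2
  linarith

def auxF (a ε : ℝ) : ℝ → ℂ :=
  indicator (Ioc 0 π) fun φ => (((max |cos φ| ε) ^ (-a) : ℝ) : ℂ)

lemma auxm_cont (a ε : ℝ) (hε : 0 < ε) : Continuous fun φ => (max |cos φ| ε) ^ (-a) := by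
  refine Continuous.rpow_const (by fun_prop) fun θ => Or.inl ?_
  have := le_max_right |cos θ| ε
  linarith

lemma auxF_meas (a ε : ℝ) (hε : 0 < ε) : Measurable (auxF a ε) := by
  have := auxm_cont a ε hε
  exact (by fun_prop : Continuous fun φ => (((max |cos φ| ε) ^ (-a) : ℝ) : ℂ)).measurable.indicator
    measurableSet_Ioc

lemma aux_fold (k : ℝ → ℝ) (hk : Continuous k) :
    ∫ φ in (0:ℝ)..π, k φ = ∫ θ in (0:ℝ)..(π/2), (k (π/2 - θ) + k (π/2 + θ)) := by
  rw [intervalIntegral.integral_add ((by fun_prop : Continuous _).intervalIntegrable _ _)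
    ((by fun_prop : Continuous _).intervalIntegrable _ _),
    intervalIntegral.integral_comp_sub_left, intervalIntegral.integral_comp_add_left]
  rw [sub_self, sub_zero, add_zero, add_halves]
  exact (intervalIntegral.integral_add_adjacent_intervals (hk.intervalIntegrable _ _)
    (hk.intervalIntegrable _ _)).symm

lemma aux_im (f : ℝ → ℂ) (hf : Continuous f) (a b : ℝ) :
    (∫ φ in a..b, f φ).im = ∫ φ in a..b, (f φ).im := by
  have := Complex.imCLM.intervalIntegral_comp_comm (hf.intervalIntegrable (μ := volume) a b)
  simpa using this.symm

lemma aux_Rext (a x y T ε : ℝ) (ha : 0 ≤ a) (hx0 : 0 ≤ x) (hx1 : x ≤ 1)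
    (hT0 : 0 < T) (hT1 : T ≤ 1) (hy : y = 1 / T^2) (hε : 0 < ε) (hεT : ε ≤ sin T) :
    T ^ (1 - a) / (6144 * π) ≤ ‖Rext (auxF a ε) x y‖ := by
  have hpi := Real.pi_pos
  have hm := auxm_cont a ε hε
  set K : ℝ → ℂ := fun φ => (((max |cos φ| ε) ^ (-a) : ℝ) : ℂ) *
    Complex.exp (Complex.I * Complex.ofReal (x * Real.cos φ + y * Real.sin φ)) with hK
  have hKc : Continuous K := by simp only [hK]; fun_prop
  have hI : ∫ φ in (0:ℝ)..(2 * π),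
      auxF a ε φ * Complex.exp (Complex.I * Complex.ofReal (x * Real.cos φ + y * Real.sin φ))
      = ∫ φ in (0:ℝ)..π, K φ := by
    rw [intervalIntegral.integral_of_le (by linarith), intervalIntegral.integral_of_le (by linarith)]
    have : (fun φ => auxF a ε φ * Complex.exp (Complex.I * Complex.ofReal (x * Real.cos φ + y * Real.sin φ)))
      = indicator (Ioc 0 π) K := by
      funext φ
      by_cases h : φ ∈ Ioc 0 π <;> simp [auxF, hK, h]
    rw [this, setIntegral_indicator measurableSet_Ioc]
    congr 2
    exact inter_eq_right.mpr (Ioc_subset_Ioc_right (by linarith))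
  have hnorm : ‖∫ φ in (0:ℝ)..π, K φ‖ =
      ‖∫ φ in (0:ℝ)..π, Complex.exp (Complex.ofReal (-y) * Complex.I) * K φ‖ := by
    rw [intervalIntegral.integral_const_mul, norm_mul, Complex.norm_exp_ofReal_mul_I, one_mul]
  have him : (∫ φ in (0:ℝ)..π, Complex.exp (Complex.ofReal (-y) * Complex.I) * K φ).im =
      ∫ φ in (0:ℝ)..π, (max |cos φ| ε) ^ (-a) * sin (x * cos φ + y * sin φ - y) := by
    rw [aux_im _ (by fun_prop)]
    congr 1
    funext φ
    have : Complex.exp (Complex.ofReal (-y) * Complex.I) * K φ =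
      (((max |cos φ| ε) ^ (-a) : ℝ) : ℂ) *
        Complex.exp (Complex.ofReal (x * cos φ + y * sin φ - y) * Complex.I) := by
      simp only [hK]
      rw [mul_left_comm, ← Complex.exp_add]
      congr 2
      push_cast
      ring
    rw [this, Complex.im_ofReal_mul, Complex.exp_ofReal_mul_I_im]
  have hfold := aux_fold (fun φ => (max |cos φ| ε) ^ (-a) * sin (x * cos φ + y * sin φ - y))
    (by fun_prop)
  have heq : ∫ φ in (0:ℝ)..π, (max |cos φ| ε) ^ (-a) * sin (x * cos φ + y * sin φ - y) =
     -2 * ∫ θ in (0:ℝ)..(π/2), (max (sin θ) ε) ^ (-a) * cos (x * sin θ) *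
      sin (y * (1 - cos θ)) := by
    rw [hfold, ← intervalIntegral.integral_const_mul]
    apply intervalIntegral.integral_congr
    intro θ hθ
    rw [uIcc_of_le (by linarith)] at hθ
    have hs : 0 ≤ sin θ := sin_nonneg_of_nonneg_of_le_pi hθ.1 (by linarith [hθ.2])
    have e1 : cos (π/2 + θ) = - sin θ := by rw [add_comm, cos_add_pi_div_two]
    have e2 : sin (π/2 + θ) = cos θ := by rw [add_comm, sin_add_pi_div_two]
    simp only [cos_pi_div_two_sub, sin_pi_div_two_sub, e1, e2, abs_neg, abs_of_nonneg hs]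
    rw [show x * sin θ + y * cos θ - y = x * sin θ - y * (1 - cos θ) by ring,
      show x * -sin θ + y * cos θ - y = -(x * sin θ + y * (1 - cos θ)) by ring, sin_neg,
      sin_add, sin_sub]
    ring
  have hreal := aux_real a x y T ε ha hx0 hx1 hT0 hT1 hy hε hεT
  have hlow : 2 * (T ^ (1 - a) / 6144) ≤ ‖∫ φ in (0:ℝ)..π, K φ‖ := by
    rw [hnorm]
    refine le_trans ?_ (Complex.abs_im_le_norm _)
    rw [him, heq, abs_mul]
    refine le_trans ?_ (mul_le_mul_of_nonneg_left (le_abs_self _) (abs_nonneg _))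
    norm_num
    linarith
  unfold Rext
  rw [hI, norm_mul, Complex.norm_real, Real.norm_eq_abs, abs_of_pos (by positivity)]
  calc T ^ (1 - a) / (6144 * π) = 1 / (2*π) * (2 * (T ^ (1 - a) / 6144)) := by field_simp
    _ ≤ _ := mul_le_mul_of_nonneg_left hlow (by positivity)

lemma aux_int (L ε : ℝ) (hL : 2 ≤ L) (hε : ε = exp (-L) / 2) :
    ∫ φ in (0:ℝ)..π, (max |cos φ| ε)⁻¹ ≤ 4 * π * L := by
  have hpi := Real.pi_pos
  have hε0 : 0 < ε := by rw [hε]; positivity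
  have hε1 : ε ≤ 1/2 := by
    rw [hε]; have : exp (-L) ≤ 1 := exp_le_one_iff.mpr (by linarith)
    linarith
  have hc : Continuous fun φ => (max |cos φ| ε)⁻¹ :=
    Continuous.inv₀ (by fun_prop) fun φ => by
      have := le_max_right |cos φ| ε
      linarith
  rw [aux_fold _ hc]
  have hcs : ContinuousOn (fun θ => 4 / (2/π*θ + ε)) (uIcc 0 (π/2)) := by
    refine ContinuousOn.div (by fun_prop) (by fun_prop) fun θ hθ => ?_
    rw [uIcc_of_le (by linarith)] at hθ
    have := hθ.1
    positivity
  have h1 : ∫ θ in (0:ℝ)..(π/2), ((max |cos (π/2 - θ)| ε)⁻¹ + (max |cos (π/2 + θ)| ε)⁻¹) ≤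
      ∫ θ in (0:ℝ)..(π/2), 4 / (2/π*θ + ε) := by
    apply intervalIntegral.integral_mono_on (by linarith) _ hcs.intervalIntegrable
    · intro θ hθ
      have hs := mul_le_sin hθ.1 hθ.2
      have := hθ.1
      have hs0 : 0 ≤ 2/π*θ := by positivity
      rw [cos_pi_div_two_sub, add_comm (π/2), cos_add_pi_div_two, abs_neg, abs_of_nonneg (by linarith)]
      have hM : (2/π*θ + ε)/2 ≤ max (sin θ) ε := by
        linarith [le_max_left (sin θ) ε, le_max_right (sin θ) ε]
      have := inv_anti₀ (by positivity) hM
      calc _ ≤ ((2/π*θ + ε)/2)⁻¹ + ((2/π*θ + ε)/2)⁻¹ := add_le_add this this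
        _ = _ := by field_simp; norm_num
    · exact ((hc.comp (by fun_prop : Continuous fun θ => π/2 - θ)).add
        (hc.comp (by fun_prop : Continuous fun θ => π/2 + θ))).intervalIntegrable _ _
  refine h1.trans ?_
  have h2 : ∫ θ in (0:ℝ)..(π/2), 4 / (2/π*θ + ε) =
      2 * π * log (2/π*(π/2) + ε) - 2 * π * log (2/π*0+ε) := by
    apply intervalIntegral.integral_eq_sub_of_hasDerivAt (f := fun θ => 2 * π * log (2/π*θ + ε)) _
      hcs.intervalIntegrable
    intro θ hθ
    rw [uIcc_of_le (by linarith)] at hθ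
    have := hθ.1
    have hne : 2/π*θ + ε ≠ 0 := by positivity
    have := (((((hasDerivAt_id θ).const_mul (2/π)).add_const ε).log hne).const_mul (2*π))
    refine this.congr_deriv ?_
    simp only [id]
    field_simp
    norm_num
  rw [h2]
  have e1 : 2/π*(π/2) + ε = 1 + ε := by field_simp
  have e2 : log ε = -L - log 2 := by
    rw [hε, log_div (exp_pos _).ne' (by norm_num), log_exp]
  rw [e1, mul_zero, zero_add, e2]
  have h3 : log (1+ε) ≤ 1/2 := by
    have := log_le_sub_one_of_pos (show 0 < 1 + ε by linarith)
    linarith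
  have h4 : log 2 ≤ 1 := by
    have := log_le_sub_one_of_pos (show (0:ℝ) < 2 by norm_num)
    linarith
  nlinarith

lemma aux_circle (r : ℝ≥0∞) (hr : 1 < r) (L ε : ℝ) (hL : 2 ≤ L) (hε : ε = exp (-L) / 2) :
    circleLp r (auxF r⁻¹.toReal ε) ≤ ENNReal.ofReal ((4 * π * L) ^ r⁻¹.toReal) := by
  have hpi := Real.pi_pos
  have hε0 : 0 < ε := by rw [hε]; positivity
  unfold circleLp
  by_cases hrt : r = ⊤
  · subst hrt
    have : ∀ᵐ x ∂(volume.restrict (Ioc (0:ℝ) (2 * π))), ‖auxF (⊤:ℝ≥0∞)⁻¹.toReal ε x‖ ≤ 1 := by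
      refine Eventually.of_forall fun φ => ?_
      by_cases h : φ ∈ Ioc 0 π <;> simp [auxF, h]
    refine (eLpNorm_le_of_ae_bound this).trans ?_
    simp
  · have hr0 : r ≠ 0 := by rintro rfl; simp at hr
    have hrr : 0 < r.toReal := ENNReal.toReal_pos hr0 hrt
    have hc : Continuous fun φ => (max |cos φ| ε)⁻¹ :=
      Continuous.inv₀ (by fun_prop) fun φ => by
        have := le_max_right |cos φ| ε
        linarith
    rw [eLpNorm_eq_lintegral_rpow_enorm_toReal hr0 hrt, ENNReal.toReal_inv,
      ← ENNReal.ofReal_rpow_of_nonneg (by positivity) (by positivity), one_div]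
    apply ENNReal.rpow_le_rpow _ (by positivity)
    have hpt : ∀ φ, ‖auxF r.toReal⁻¹ ε φ‖ₑ ^ r.toReal =
        indicator (Ioc 0 π) (fun φ => ENNReal.ofReal (max |cos φ| ε)⁻¹) φ := by
      intro φ
      have hM : 0 < max |cos φ| ε := lt_max_of_lt_right hε0
      by_cases h : φ ∈ Ioc 0 π
      · simp only [auxF, h, indicator_of_mem]
        rw [← ofReal_norm, Complex.norm_real, Real.norm_eq_abs, abs_of_pos (by positivity),
          ENNReal.ofReal_rpow_of_nonneg (by positivity) hrr.le, ← rpow_mul hM.le]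
        congr 1
        rw [neg_mul, inv_mul_cancel₀ hrr.ne', rpow_neg_one]
      · simp [auxF, h, hrr]
    simp_rw [hpt]
    refine (lintegral_mono' Measure.restrict_le_self le_rfl).trans ?_
    rw [lintegral_indicator measurableSet_Ioc, ← ofReal_integral_eq_lintegral_ofReal]
    · rw [← intervalIntegral.integral_of_le hpi.le]
      exact ENNReal.ofReal_le_ofReal (aux_int L ε hL hε)
    · exact (hc.intervalIntegrable 0 π).1
    · exact Eventually.of_forall fun φ => by
        have hM : 0 < max |cos φ| ε := lt_max_of_lt_right hε0
        simp only [Pi.zero_apply]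
        positivity

lemma aux_point (α β a q x y L ε : ℝ) (ha : 0 ≤ a) (hβ0 : 0 ≤ β) (hβα : β ≤ α)
    (hβq : β = 1 / q - (1 - a) / 2) (hε : ε = exp (-L) / 2)
    (hx : x ∈ Icc (0:ℝ) 1) (hy : y ∈ Icc 1 (exp (2*L))) :
    2 ^ (-α) * 2 ^ (-β) / (6144 * π) * y ^ (-(1/q)) ≤ ‖Rab α β (auxF a ε) x y‖ := by
  have hpi := Real.pi_pos
  have hpi4 := Real.pi_lt_four
  have hpi3 := Real.pi_gt_three
  have hε0 : 0 < ε := by rw [hε]; positivity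
  have hy0 : 0 < y := by linarith [hy.1]
  obtain ⟨T, hT⟩ : ∃ T, T = y ^ (-(1/2) : ℝ) := ⟨_, rfl⟩
  have hT0 : 0 < T := by rw [hT]; positivity
  have hT1 : T ≤ 1 := by rw [hT]; exact rpow_le_one_of_one_le_of_nonpos hy.1 (by norm_num)
  have hyT : y = 1 / T^2 := by
    rw [hT, ← rpow_natCast, ← rpow_mul hy0.le]
    norm_num
    rw [rpow_neg_one, inv_inv]
  have hTe : exp (-L) ≤ T := by
    have := rpow_le_rpow_of_nonpos hy0 hy.2 (show (-(1/2):ℝ) ≤ 0 by norm_num)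
    rw [← hT, ← exp_mul] at this
    convert this using 2
    ring
  have hεT : ε ≤ sin T := by
    have := mul_le_sin hT0.le (by linarith)
    have c7 : 1/2 ≤ 2/π := by rw [div_le_div_iff₀] <;> linarith
    rw [hε]
    nlinarith
  have h1 := aux_Rext a x y T ε ha hx.1 hx.2 hT0 hT1 hyT hε0 hεT
  unfold Rab
  rw [norm_mul, Complex.norm_real, Real.norm_eq_abs, abs_of_nonneg hx.1, abs_of_nonneg hy0.le]
  have hx0 := hx.1
  rw [abs_of_nonneg (by positivity)]
  have h2 : (2:ℝ) ^ (-α) ≤ (1 + x) ^ (-α) :=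
    rpow_le_rpow_of_nonpos (by positivity) (by linarith [hx.2]) (by linarith)
  have h3 : (2:ℝ) ^ (-β) * y ^ (-β) ≤ (1 + y) ^ (-β) := by
    rw [← mul_rpow (by norm_num) hy0.le]
    exact rpow_le_rpow_of_nonpos (by positivity) (by linarith [hy.1]) (by linarith)
  have h4 : T ^ (1 - a) * y ^ (-β) = y ^ (-(1/q)) := by
    rw [hT, ← rpow_mul hy0.le, ← rpow_add hy0]
    congr 1
    rw [hβq]; ring
  rw [← h4]
  calc _ = T ^ (1 - a) / (6144 * π) * (2 ^ (-α) * (2 ^ (-β) * y ^ (-β))) := by ring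
    _ ≤ _ := by gcongr

lemma aux_plane (α β a q L ε : ℝ) (ha : 0 ≤ a) (hβ0 : 0 ≤ β) (hβα : β ≤ α) (hq : 0 < q)
    (hβq : β = 1 / q - (1 - a) / 2) (hε : ε = exp (-L) / 2) (hL : 2 ≤ L) :
    ENNReal.ofReal (2 ^ (-α) * 2 ^ (-β) / (6144 * π) * (2 * L) ^ (1/q)) ≤
      planeLp (ENNReal.ofReal q) (fun p => Rab α β (auxF a ε) p.1 p.2) := by
  have hpi := Real.pi_pos
  obtain ⟨c, hc⟩ : ∃ c : ℝ, c = 2 ^ (-α) * 2 ^ (-β) / (6144 * π) := ⟨_, rfl⟩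
  have hc0 : 0 < c := by rw [hc]; positivity
  have hY : 1 ≤ exp (2*L) := one_le_exp (by linarith)
  rw [← hc]
  unfold planeLp
  rw [eLpNorm_eq_lintegral_rpow_enorm_toReal (by simpa using hq) ENNReal.ofReal_ne_top,
    ENNReal.toReal_ofReal hq.le]
  have e1 : ENNReal.ofReal (c * (2 * L) ^ (1/q)) = (ENNReal.ofReal (c^q * (2*L))) ^ (1/q) := by
    rw [ENNReal.ofReal_rpow_of_nonneg (by positivity) (by positivity),
      mul_rpow (x := c^q) (by positivity) (by positivity), ← rpow_mul hc0.le, mul_one_div_cancel hq.ne', rpow_one]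
  rw [e1]
  apply ENNReal.rpow_le_rpow _ (by positivity)
  set S : Set (ℝ × ℝ) := Icc (0:ℝ) 1 ×ˢ Icc (1:ℝ) (exp (2*L)) with hS
  have hSm : MeasurableSet S := measurableSet_Icc.prod measurableSet_Icc
  have hcont : ContinuousOn (fun y : ℝ => c^q * y⁻¹) (Icc 1 (exp (2*L))) :=
    ContinuousOn.mul (by fun_prop) (ContinuousOn.inv₀ (by fun_prop) fun y hy => by linarith [hy.1])
  calc ENNReal.ofReal (c^q * (2*L))
      = ∫⁻ y in Icc 1 (exp (2*L)), ENNReal.ofReal (c^q * y⁻¹) := by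
        rw [← ofReal_integral_eq_lintegral_ofReal]
        · rw [integral_Icc_eq_integral_Ioc, ← intervalIntegral.integral_of_le hY,
            intervalIntegral.integral_const_mul, integral_inv_of_pos one_pos (exp_pos _), div_one,
            log_exp]
        · exact hcont.integrableOn_Icc
        · filter_upwards [ae_restrict_mem measurableSet_Icc] with y hy
          have := hy.1
          simp only [Pi.zero_apply]
          positivity
    _ = ∫⁻ p in S, ENNReal.ofReal (c^q * p.2⁻¹) := by
        rw [hS, Measure.volume_eq_prod, ← Measure.prod_restrict]
        have := lintegral_prod_mul (μ := volume.restrict (Icc (0:ℝ) 1))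
          (ν := volume.restrict (Icc (1:ℝ) (exp (2*L)))) (f := fun _ => 1)
          (g := fun y => ENNReal.ofReal (c^q * y⁻¹)) (by fun_prop) (by fun_prop)
        simp only [one_mul] at this
        rw [this]
        simp
    _ ≤ ∫⁻ p in S, ‖Rab α β (auxF a ε) p.1 p.2‖ₑ ^ q := by
        apply setLIntegral_mono' hSm
        intro p hp
        have hy := hp.2
        have hy0 : 0 < p.2 := by linarith [hy.1]
        have := aux_point α β a q p.1 p.2 L ε ha hβ0 hβα hβq hε hp.1 hp.2
        rw [← hc] at this
        rw [← ofReal_norm, ENNReal.ofReal_rpow_of_nonneg (norm_nonneg _) hq.le]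
        apply ENNReal.ofReal_le_ofReal
        have e : c^q * p.2⁻¹ = (c * p.2 ^ (-(1/q))) ^ q := by
          rw [mul_rpow hc0.le (by positivity), ← rpow_mul hy0.le, neg_mul,
            one_div_mul_cancel hq.ne', rpow_neg_one]
        rw [e]
        exact rpow_le_rpow (by positivity) this hq.le
    _ ≤ _ := setLIntegral_le_lintegral _ _

/-- Lemma 13 (necessity of `q ≥ r` for endpoint estimates with `α > 1/q`,
`β = 1/q - 1/(2r')`), with `q ≥ r` read as `1/q ≤ 1/r`. -/
theorem statement10 (α β : ℝ) (hβ0 : 0 ≤ β) (hβα : β ≤ α)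
    (r : ℝ≥0∞) (hr : 1 < r) (q : ℝ) (hq : 0 < q)
    (hαq : α > 1 / q) (hβq : β = 1 / q - (1 - r⁻¹.toReal) / 2)
    (hbdd : ∃ C : ℝ, 0 < C ∧ ∀ F : ℝ → ℂ, Measurable F →
      planeLp (ENNReal.ofReal q) (fun p => Rab α β F p.1 p.2) ≤
        ENNReal.ofReal C * circleLp r F) :
    1 / q ≤ r⁻¹.toReal := by
  obtain ⟨C, hC, hF⟩ := hbdd
  obtain ⟨a, ha⟩ : ∃ a, a = r⁻¹.toReal := ⟨_, rfl⟩
  have ha0 : 0 ≤ a := by rw [ha]; exact ENNReal.toReal_nonneg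
  have hpi := Real.pi_pos
  rw [← ha] at hβq ⊢
  by_contra hcon
  push Not at hcon
  obtain ⟨c, hc⟩ : ∃ c : ℝ, c = 2 ^ (-α) * 2 ^ (-β) / (6144 * π) := ⟨_, rfl⟩
  have hc0 : 0 < c := by rw [hc]; positivity
  have key : ∀ L, 2 ≤ L → c * (2 * L) ^ (1/q) ≤ C * (4 * π * L) ^ a := by
    intro L hL
    have h1 := aux_plane α β a q L _ ha0 hβ0 hβα hq hβq rfl hL
    have h2 := hF (auxF a (exp (-L) / 2)) (auxF_meas _ _ (by positivity))
    have h3 := aux_circle r hr L _ hL rfl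
    rw [← ha] at h3
    rw [← hc] at h1
    have h4 := h1.trans (h2.trans (mul_le_mul_right h3 _))
    rw [← ENNReal.ofReal_mul hC.le] at h4
    exact (ENNReal.ofReal_le_ofReal_iff (by positivity)).mp h4
  have ht := tendsto_rpow_atTop (show 0 < 1/q - a by linarith)
  obtain ⟨L, hL, hL2⟩ := ((ht.eventually_gt_atTop (C * (4*π)^a / (c * 2^(1/q)))).and
    (eventually_ge_atTop 2)).exists
  have hL0 : 0 < L := by linarith
  have hk := key L hL2
  rw [mul_rpow (by norm_num) hL0.le, mul_rpow (by positivity) hL0.le] at hk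
  rw [rpow_sub hL0, div_lt_div_iff₀ (by positivity) (by positivity)] at hL
  linarith
end
end

section
/- Let 0 ≤ β ≤ α < 1/2 and 1 ≤ r ≤ ∞, and assume α + β > 1/2 and α + 2β = 3/2 − 1/r′. If there exists C > 0 such that ‖R*_{α,β}F‖_{L²(ℝ²)} ≤ C · ‖F‖_{L^r(S¹)} for all measurable F : ℝ → ℂ, then r ≤ 2. -/
open MeasureTheory Real Set Filter
open scoped ENNReal

noncomputable section

def Qf (α β : ℝ) (F : ℝ → ℂ) : ℝ≥0∞ := ∫⁻ p : ℝ × ℝ, ‖Rab α β F p.1 p.2‖ₑ ^ 2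

lemma planeLp_sq (α β : ℝ) (F : ℝ → ℂ) :
    (planeLp 2 (fun p => Rab α β F p.1 p.2)) ^ 2 = Qf α β F := by
  unfold planeLp Qf
  rw [eLpNorm_eq_lintegral_rpow_enorm_toReal (by norm_num) (by norm_num)]
  rw [← ENNReal.rpow_natCast, ← ENNReal.rpow_mul]
  simp

lemma ker_cont (x y : ℝ) : Continuous (fun φ : ℝ =>
    Complex.exp (Complex.I * Complex.ofReal (x * Real.cos φ + y * Real.sin φ))) := by
  fun_prop

lemma meas_Rab (α β : ℝ) (F : ℝ → ℂ) (hF : Measurable F) :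
    Measurable (fun p : ℝ × ℝ => Rab α β F p.1 p.2) := by
  unfold Rab Rext
  refine Measurable.mul (Measurable.const_mul ?_ _) ?_
  · simp only [intervalIntegral.integral_of_le Real.two_pi_pos.le]
    have : StronglyMeasurable (fun q : (ℝ × ℝ) × ℝ => F q.2 * Complex.exp (Complex.I *
        Complex.ofReal (q.1.1 * Real.cos q.2 + q.1.2 * Real.sin q.2))) := by
      apply Measurable.stronglyMeasurable
      fun_prop
    exact (this.integral_prod_right (ν := volume.restrict (Ioc (0:ℝ) (2*π)))).measurable
  · fun_prop

lemma Rab_add (α β : ℝ) (F G : ℝ → ℂ) (hF : IntervalIntegrable F volume 0 (2*π))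
    (hG : IntervalIntegrable G volume 0 (2*π)) (x y : ℝ) :
    Rab α β (F + G) x y = Rab α β F x y + Rab α β G x y := by
  unfold Rab Rext
  simp only [Pi.add_apply, add_mul]
  rw [intervalIntegral.integral_add (hF.mul_continuousOn (ker_cont x y).continuousOn)
    (hG.mul_continuousOn (ker_cont x y).continuousOn)]
  ring

lemma Rab_neg (α β : ℝ) (G : ℝ → ℂ) (x y : ℝ) :
    Rab α β (-G) x y = - Rab α β G x y := by
  unfold Rab Rext
  simp only [Pi.neg_apply, neg_mul, intervalIntegral.integral_neg, mul_neg]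

lemma par (a b : ℂ) : ‖a + b‖ₑ ^ 2 + ‖a - b‖ₑ ^ 2 = 2 * (‖a‖ₑ ^ 2 + ‖b‖ₑ ^ 2) := by
  have h := parallelogram_law_with_norm ℝ a b
  simp only [← ofReal_norm]
  rw [← ENNReal.ofReal_pow (norm_nonneg _), ← ENNReal.ofReal_pow (norm_nonneg _),
    ← ENNReal.ofReal_pow (norm_nonneg _), ← ENNReal.ofReal_pow (norm_nonneg _),
    ← ENNReal.ofReal_add (by positivity) (by positivity),
    ← ENNReal.ofReal_add (by positivity) (by positivity),
    show (2:ℝ≥0∞) = ENNReal.ofReal 2 by simp, ← ENNReal.ofReal_mul (by norm_num)]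
  congr 1

lemma Q_step (α β : ℝ) (F G : ℝ → ℂ) (mF : Measurable F) (mG : Measurable G)
    (hF : IntervalIntegrable F volume 0 (2*π))
    (hG : IntervalIntegrable G volume 0 (2*π)) :
    Qf α β F + Qf α β G ≤ Qf α β (F + G) ∨ Qf α β F + Qf α β G ≤ Qf α β (F + -G) := by
  by_contra! h
  have h1 : Qf α β (F + G) + Qf α β (F + -G) = 2 * (Qf α β F + Qf α β G) := by
    unfold Qf
    rw [← lintegral_add_left ((meas_Rab α β _ (mF.add mG)).enorm.pow_const 2),
      ← lintegral_add_left ((meas_Rab α β _ mF).enorm.pow_const 2), ← lintegral_const_mul]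
    · congr 1
      ext p
      rw [Rab_add _ _ _ _ hF hG, Rab_add _ _ _ _ hF hG.neg, Rab_neg, ← sub_eq_add_neg, par]
    · exact ((meas_Rab α β _ mF).enorm.pow_const 2).add ((meas_Rab α β _ mG).enorm.pow_const 2)
  have := ENNReal.add_lt_add h.1 h.2
  rw [h1, two_mul] at this
  exact lt_irrefl _ this

def fd (s δ : ℝ) : ℝ → ℂ :=
  (Ioc (π/2 + δ/2) (π/2 + δ)).indicator (fun φ => (((φ - π/2) ^ (-s) : ℝ) : ℂ))

lemma fd_meas (s δ : ℝ) : Measurable (fd s δ) := by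
  unfold fd
  refine Measurable.indicator ?_ measurableSet_Ioc
  fun_prop

lemma fd_bound (s δ : ℝ) (hs : 0 ≤ s) (hδ : 0 < δ) (φ : ℝ) : ‖fd s δ φ‖ ≤ (δ/2) ^ (-s) := by
  unfold fd
  by_cases h : φ ∈ Ioc (π/2 + δ/2) (π/2 + δ)
  · rw [indicator_of_mem h, Complex.norm_real, Real.norm_eq_abs, abs_of_nonneg]
    · exact Real.rpow_le_rpow_of_nonpos (by linarith) (by linarith [h.1]) (by linarith)
    · exact Real.rpow_nonneg (by linarith [h.1]) _
  · rw [indicator_of_notMem h]; simp; positivity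

lemma fd_int (s δ : ℝ) (hs : 0 ≤ s) (hδ : 0 < δ) :
    IntervalIntegrable (fd s δ) volume 0 (2*π) := by
  rw [intervalIntegrable_iff]
  exact Measure.integrableOn_of_bounded (M := (δ/2)^(-s)) (by simp [ENNReal.mul_eq_top])
    (fd_meas s δ).aestronglyMeasurable (ae_of_all _ (fd_bound s δ hs hδ))

lemma phase_bound (δ t x y : ℝ) (hδ : 0 < δ) (ht0 : 0 ≤ t) (ht : t ≤ δ)
    (hx : x ∈ Icc 0 (1/(2*δ))) (hy : y ∈ Icc 0 (1/δ^2)) :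
    1/2 ≤ Real.cos (x * Real.cos (π/2 + t) + y * Real.sin (π/2 + t) - y) := by
  have e1 : Real.cos (π/2 + t) = - Real.sin t := by
    rw [add_comm, Real.cos_add_pi_div_two]
  have e2 : Real.sin (π/2 + t) = Real.cos t := by
    rw [add_comm, Real.sin_add_pi_div_two]
  rw [e1, e2]
  have h1 : |Real.sin t| ≤ t := by
    have := Real.abs_sin_le_abs (x := t); rwa [abs_of_nonneg ht0] at this
  have h2 := Real.one_sub_sq_div_two_le_cos (x := t)
  have h3 := Real.cos_le_one t
  have hxt : x * t ≤ 1/2 := by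
    calc x * t ≤ 1/(2*δ) * δ := mul_le_mul hx.2 ht ht0 (by positivity)
      _ = 1/2 := by field_simp
  have hyt : y * t^2 ≤ 1 := by
    calc y * t^2 ≤ 1/δ^2 * δ^2 := mul_le_mul hy.2 (by gcongr) (by positivity) (by positivity)
      _ = 1 := by field_simp
  have hb : |x * -Real.sin t + y * Real.cos t - y| ≤ 1 := by
    rw [abs_le] at h1 ⊢
    have hx0 := hx.1
    have hy0 := hy.1
    constructor <;> nlinarith [mul_nonneg hx0 (sub_nonneg.2 h1.2),
      mul_nonneg hx0 (by linarith [h1.1] : 0 ≤ Real.sin t + t), mul_nonneg hy0 (sub_nonneg.2 h3),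
      mul_nonneg hy0 (sub_nonneg.2 h2)]
  have := Real.one_sub_sq_div_two_le_cos (x := x * -Real.sin t + y * Real.cos t - y)
  have h5 : (x * -Real.sin t + y * Real.cos t - y)^2 ≤ 1 := by
    rw [← sq_abs]; nlinarith [abs_nonneg (x * -Real.sin t + y * Real.cos t - y)]
  linarith

lemma Rext_lower (s δ x y : ℝ) (hs : 0 ≤ s) (hδ : 0 < δ) (hδ1 : δ ≤ 1)
    (hx : x ∈ Icc 0 (1/(2*δ))) (hy : y ∈ Icc 0 (1/δ^2)) :
    1/(8*π) * δ ^ (1 - s) ≤ ‖Rext (fd s δ) x y‖ := by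
  have hpi := Real.pi_gt_three
  unfold Rext
  set J := ∫ φ in (0:ℝ)..(2 * π), fd s δ φ *
    Complex.exp (Complex.I * Complex.ofReal (x * Real.cos φ + y * Real.sin φ)) with hJ
  have key : 1/4 * δ^(1-s) ≤ ‖J‖ := by
    have hn : ‖J‖ = ‖J * Complex.exp (Complex.I * Complex.ofReal (-y))‖ := by
      rw [norm_mul, mul_comm Complex.I, Complex.norm_exp_ofReal_mul_I, mul_one]
    rw [hn]
    refine le_trans ?_ (Complex.re_le_norm _)
    have hint : IntervalIntegrable (fun φ => fd s δ φ *
        Complex.exp (Complex.I * Complex.ofReal (x * Real.cos φ + y * Real.sin φ))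
        * Complex.exp (Complex.I * Complex.ofReal (-y))) volume 0 (2*π) :=
      ((fd_int s δ hs hδ).mul_continuousOn (ker_cont x y).continuousOn).mul_const _
    rw [hJ, ← intervalIntegral.integral_mul_const]
    rw [intervalIntegral.integral_of_le Real.two_pi_pos.le] 
    rw [intervalIntegrable_iff, uIoc_of_le Real.two_pi_pos.le] at hint
    have hre := integral_re hint
    simp only [RCLike.re_to_complex] at hre
    rw [← hre]
    have hsub : Ioc (π/2 + δ/2) (π/2 + δ) ⊆ Ioc 0 (2*π) := by
      intro z hz; constructor <;> linarith [hz.1, hz.2]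
    calc 1/4 * δ^(1-s) = ∫ φ in Ioc 0 (2*π), 
          (Ioc (π/2 + δ/2) (π/2 + δ)).indicator (fun _ => 1/2 * δ^(-s)) φ := by
          rw [integral_indicator measurableSet_Ioc, Measure.restrict_restrict measurableSet_Ioc,
            inter_eq_left.2 hsub, setIntegral_const, Real.volume_real_Ioc_of_le (by linarith),
            show (1 - s) = 1 + -s by ring, Real.rpow_add hδ, Real.rpow_one]
          simp; ring
      _ ≤ _ := by
          refine integral_mono ?_ hint.re ?_
          · rw [integrable_indicator_iff measurableSet_Ioc]
            refine integrableOn_const ?_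
            exact ne_of_lt (lt_of_le_of_lt (Measure.restrict_apply_le _ _) (by simp))
          · intro φ
            by_cases h : φ ∈ Ioc (π/2 + δ/2) (π/2 + δ)
            · simp only [fd, indicator_of_mem h]
              have hc : Complex.exp (Complex.I * Complex.ofReal (x * Real.cos φ + y * Real.sin φ))
                * Complex.exp (Complex.I * Complex.ofReal (-y)) = 
                Complex.exp (Complex.ofReal (x * Real.cos φ + y * Real.sin φ - y) * Complex.I) := by
                rw [← Complex.exp_add]; congr 1; push_cast; ring
              rw [mul_assoc, hc, Complex.re_ofReal_mul, Complex.exp_ofReal_mul_I_re]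
              have hp := phase_bound δ (φ - π/2) x y hδ (by linarith [h.1]) (by linarith [h.2]) hx hy
              rw [show π/2 + (φ - π/2) = φ by ring] at hp
              have : δ^(-s) ≤ (φ-π/2)^(-s) :=
                Real.rpow_le_rpow_of_nonpos (by linarith [h.1]) (by linarith [h.2]) (by linarith)
              have h0 : 0 ≤ δ^(-s) := by positivity
              nlinarith
            · simp [fd, indicator_of_notMem h]
  rw [norm_mul, Complex.norm_real, Real.norm_eq_abs, abs_of_nonneg (by positivity)]
  calc 1/(8*π) * δ^(1-s) = 1/(2*π) * (1/4 * δ^(1-s)) := by field_simp; norm_num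
    _ ≤ _ := by gcongr

def cst (α β : ℝ) : ℝ := (1/(8*π) * (2 ^ (-α) * 2^(-β)))

lemma Rab_lower (α β s δ x y : ℝ) (hs : 0 ≤ s) (hα : 0 ≤ α) (hβ : 0 ≤ β)
    (he : α + 2 * β = 1/2 + s) (hδ : 0 < δ) (hδ1 : δ ≤ 1)
    (hx : x ∈ Icc 0 (1/(2*δ))) (hy : y ∈ Icc 0 (1/δ^2)) :
    cst α β * δ ^ (3/2:ℝ) ≤ ‖Rab α β (fd s δ) x y‖ := by
  unfold Rab
  have hx0 := hx.1
  have hy0 := hy.1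
  rw [norm_mul, Complex.norm_real, Real.norm_eq_abs, abs_of_nonneg (by positivity),
    abs_of_nonneg hx.1, abs_of_nonneg hy.1]
  have h1 : (2/δ)^(-α) ≤ (1+x)^(-α) := by
    refine Real.rpow_le_rpow_of_nonpos (by linarith) ?_ (by linarith)
    have := hx.2
    have h2 : 1 ≤ 1/δ := by rw [le_div_iff₀ hδ]; linarith
    have : 1/(2*δ) = (1/δ)/2 := by field_simp
    have : 2/δ = 2*(1/δ) := by ring
    linarith
  have h2 : (2/δ^2)^(-β) ≤ (1+y)^(-β) := by
    refine Real.rpow_le_rpow_of_nonpos (by linarith) ?_ (by linarith)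
    have := hy.2
    have h2 : 1 ≤ 1/δ^2 := by rw [le_div_iff₀ (by positivity)]; nlinarith
    have : 2/δ^2 = 2*(1/δ^2) := by ring
    linarith
  have h3 := Rext_lower s δ x y hs hδ hδ1 hx hy
  calc cst α β * δ ^ (3/2:ℝ) = (1/(8*π) * δ ^ (1 - s)) * ((2/δ)^(-α) * (2/δ^2)^(-β)) := by
        unfold cst
        rw [Real.div_rpow (by norm_num) hδ.le, Real.div_rpow (by norm_num) (by positivity),
          ← Real.rpow_natCast δ 2, ← Real.rpow_mul hδ.le, div_eq_mul_inv (2 ^ (-α) : ℝ), div_eq_mul_inv (2 ^ (-β) : ℝ),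
          ← Real.rpow_neg hδ.le, ← Real.rpow_neg hδ.le,
          show (3/2:ℝ) = (1-s) + (- -α) + -(((2:ℕ):ℝ) * -β) by push_cast; linarith,
          Real.rpow_add hδ, Real.rpow_add hδ]
        ring
    _ ≤ _ := by gcongr

lemma cst_pos (α β : ℝ) : 0 < cst α β := by unfold cst; positivity

lemma Q_lower (α β s δ : ℝ) (hs : 0 ≤ s) (hα : 0 ≤ α) (hβ : 0 ≤ β)
    (he : α + 2 * β = 1/2 + s) (hδ : 0 < δ) (hδ1 : δ ≤ 1) :
    ENNReal.ofReal ((cst α β)^2/2) ≤ Qf α β (fd s δ) := by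
  have hc := cst_pos α β
  unfold Qf
  calc ENNReal.ofReal ((cst α β)^2/2) 
      = ∫⁻ p in (Icc 0 (1/(2*δ))) ×ˢ (Icc 0 (1/δ^2)), ENNReal.ofReal ((cst α β * δ ^ (3/2:ℝ))^2) := by
        rw [setLIntegral_const, Measure.volume_eq_prod, Measure.prod_prod, Real.volume_Icc,
          Real.volume_Icc, ← ENNReal.ofReal_mul (by simp; positivity),
          ← ENNReal.ofReal_mul (by positivity)]
        congr 1
        rw [mul_pow, ← Real.rpow_natCast (δ^(3/2:ℝ)), ← Real.rpow_mul hδ.le]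
        norm_num
        field_simp
    _ ≤ ∫⁻ p in (Icc 0 (1/(2*δ))) ×ˢ (Icc 0 (1/δ^2)), ‖Rab α β (fd s δ) p.1 p.2‖ₑ ^ 2 := by
        refine setLIntegral_mono' (measurableSet_Icc.prod measurableSet_Icc) ?_
        intro p hp
        rw [ENNReal.ofReal_pow (by positivity), ← ofReal_norm]
        gcongr
        exact Rab_lower α β s δ p.1 p.2 hs hα hβ he hδ hδ1 hp.1 hp.2
    _ ≤ _ := setLIntegral_le_lintegral _ _

def bd (s : ℝ) (N : ℕ) : ℝ → ℝ :=
  (Ioc (π/2 + (1/2)^N) (π/2 + 1)).indicator (fun φ => (φ - π/2) ^ (-s))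

lemma build (α β s : ℝ) (hs : 0 ≤ s) (hα : 0 ≤ α) (hβ : 0 ≤ β)
    (he : α + 2 * β = 1/2 + s) (N : ℕ) : ∃ F : ℝ → ℂ, Measurable F ∧
      IntervalIntegrable F volume 0 (2*π) ∧ (∀ φ, ‖F φ‖ ≤ bd s N φ) ∧
      N * ENNReal.ofReal ((cst α β)^2/2) ≤ Qf α β F := by
  induction N with
  | zero => exact ⟨0, measurable_zero,
      (intervalIntegrable_const : IntervalIntegrable (fun _ => (0:ℂ)) volume 0 (2*π)),
      by intro φ; simp [bd], by simp⟩
  | succ N ih =>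
    obtain ⟨F, mF, iF, bF, qF⟩ := ih
    have hδ : (0:ℝ) < (1/2)^N := by positivity
    have hδ1 : ((1/2:ℝ))^N ≤ 1 := pow_le_one₀ (by norm_num) (by norm_num)
    have hQ := Q_lower α β s _ hs hα hβ he hδ hδ1
    have hb : ∀ φ, ‖F φ‖ + ‖fd s ((1/2)^N) φ‖ ≤ bd s (N+1) φ := by
      intro φ
      have h1 := bF φ
      unfold bd fd at *
      by_cases hA : φ ∈ Ioc (π/2 + (1/2)^N) (π/2 + 1)
      · have hB : φ ∉ Ioc (π/2 + (1/2)^N/2) (π/2 + (1/2)^N) := fun h => by linarith [h.2, hA.1]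
        have hC : φ ∈ Ioc (π/2 + (1/2)^(N+1)) (π/2 + 1) :=
          ⟨by rw [pow_succ]; linarith [hA.1], hA.2⟩
        rw [indicator_of_mem hA] at h1
        rw [indicator_of_notMem hB, indicator_of_mem hC]
        simpa using h1
      · rw [indicator_of_notMem hA] at h1
        by_cases hB : φ ∈ Ioc (π/2 + (1/2)^N/2) (π/2 + (1/2)^N)
        · have hC : φ ∈ Ioc (π/2 + (1/2)^(N+1)) (π/2 + 1) :=
            ⟨by rw [pow_succ]; linarith [hB.1], by linarith [hB.2]⟩
          rw [indicator_of_mem hB, indicator_of_mem hC, Complex.norm_real, Real.norm_eq_abs,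
            abs_of_nonneg (Real.rpow_nonneg (by linarith [hB.1]) _)]
          linarith
        · rw [indicator_of_notMem hB, norm_zero, add_zero]
          refine h1.trans (indicator_nonneg ?_ _)
          intro z hz
          exact Real.rpow_nonneg (by linarith [hz.1, pow_pos (by norm_num : (0:ℝ) < 1/2) (N+1)]) _
    have hq : ((N+1:ℕ):ℝ≥0∞) * ENNReal.ofReal ((cst α β)^2/2) ≤ Qf α β F + Qf α β (fd s ((1/2)^N)) := by
      push_cast
      rw [add_mul, one_mul]
      exact add_le_add qF hQ
    have mG := fd_meas s ((1/2)^N)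
    have iG := fd_int s _ hs hδ
    rcases Q_step α β F _ mF mG iF iG with h | h
    · exact ⟨_, mF.add mG, iF.add iG, fun φ => (norm_add_le _ _).trans (hb φ), hq.trans h⟩
    · refine ⟨_, mF.add mG.neg, iF.add iG.neg, fun φ => (norm_add_le _ _).trans ?_, hq.trans h⟩
      simpa using hb φ

lemma norm_upper (r : ℝ≥0∞) (hr : 2 < r) (N : ℕ) (F : ℝ → ℂ)
    (hF : ∀ φ, ‖F φ‖ ≤ bd r⁻¹.toReal N φ) :
    circleLp r F ≤ ENNReal.ofReal ((N:ℝ) ^ r⁻¹.toReal) := by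
  unfold circleLp
  have hδ : (0:ℝ) < (1/2)^N := by positivity
  have hδ1 : ((1/2:ℝ))^N ≤ 1 := pow_le_one₀ (by norm_num) (by norm_num)
  rcases eq_or_ne r ⊤ with rfl | hr'
  · simp only [ENNReal.inv_top, ENNReal.toReal_zero, Real.rpow_zero]  at *
    rw [eLpNorm_exponent_top]
    refine eLpNormEssSup_le_of_ae_bound (ae_of_all _ fun φ => (hF φ).trans ?_)
    unfold bd
    simp only [neg_zero, Real.rpow_zero]
    exact indicator_le_self' (by simp) _ |>.trans (by simp)
  · have hr0 : r ≠ 0 := (lt_trans (by norm_num) hr).ne'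
    have hp : 0 < r.toReal := ENNReal.toReal_pos hr0 hr'
    rw [eLpNorm_eq_lintegral_rpow_enorm_toReal hr0 hr', ENNReal.toReal_inv, one_div,
      ← ENNReal.ofReal_rpow_of_nonneg (by positivity) (by positivity)]
    rw [ENNReal.toReal_inv] at hF
    gcongr
    have hle : π/2 + (1/2)^N ≤ π/2 + 1 := by linarith
    have hii : IntervalIntegrable (fun φ => (φ - π/2)⁻¹) volume (π/2 + (1/2)^N) (π/2+1) := by
      refine ContinuousOn.intervalIntegrable ?_
      rw [uIcc_of_le hle]
      refine ContinuousOn.inv₀ (by fun_prop) ?_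
      intro z hz; have := hz.1; have : 0 < z - π/2 := by linarith
      exact this.ne'
    calc _ ≤ ∫⁻ φ, ‖F φ‖ₑ ^ r.toReal := setLIntegral_le_lintegral _ _
      _ ≤ ∫⁻ φ, (Ioc (π/2 + (1/2)^N) (π/2 + 1)).indicator
          (fun φ => ENNReal.ofReal ((φ - π/2)⁻¹)) φ := by
          refine lintegral_mono fun φ => ?_
          have h1 := hF φ
          unfold bd at h1
          by_cases hA : φ ∈ Ioc (π/2 + (1/2)^N) (π/2 + 1)
          · rw [indicator_of_mem hA] at h1 ⊢
            have h0 : 0 < φ - π/2 := by linarith [hA.1]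
            rw [← ofReal_norm, ENNReal.ofReal_rpow_of_nonneg (norm_nonneg _) hp.le]
            refine ENNReal.ofReal_le_ofReal ?_
            calc _ ≤ ((φ - π / 2) ^ (-r.toReal⁻¹)) ^ r.toReal := by gcongr
              _ = _ := by
                rw [← Real.rpow_mul h0.le, neg_mul, inv_mul_cancel₀ hp.ne', Real.rpow_neg_one]
          · rw [indicator_of_notMem hA] at h1 ⊢
            have : F φ = 0 := norm_le_zero_iff.1 h1
            simp [this, hp]
      _ = ENNReal.ofReal (∫ φ in (π/2 + (1/2)^N)..(π/2+1), (φ - π/2)⁻¹) := by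
          rw [lintegral_indicator measurableSet_Ioc, intervalIntegral.integral_of_le hle,
            ofReal_integral_eq_lintegral_ofReal]
          · rw [intervalIntegrable_iff, uIoc_of_le hle] at hii; exact hii
          · refine (ae_restrict_iff' measurableSet_Ioc).2 (ae_of_all _ fun z hz => ?_)
            exact inv_nonneg.2 (by linarith [hz.1])
      _ ≤ _ := by
          refine ENNReal.ofReal_le_ofReal ?_
          rw [intervalIntegral.integral_comp_sub_right (fun t => t⁻¹), add_sub_cancel_left,
            add_sub_cancel_left, integral_inv_of_pos hδ one_pos]
          rw [one_div, one_div, inv_pow, inv_inv, Real.log_pow]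
          have : Real.log 2 ≤ 1 := by linarith [Real.log_two_lt_d9]
          nlinarith [(Nat.cast_nonneg N : (0:ℝ) ≤ N)]

/-- Lemma 14: necessity of `r ≤ 2` for the endpoint `L²` estimate. -/
theorem statement11 (α β : ℝ) (hβ0 : 0 ≤ β) (hβα : β ≤ α) (hα : α < 1 / 2)
    (r : ℝ≥0∞) (hr : 1 ≤ r)
    (hsum : α + β > 1 / 2) (hend : α + 2 * β = 3 / 2 - (1 - r⁻¹.toReal))
    (hbdd : ∃ C : ℝ, 0 < C ∧ ∀ F : ℝ → ℂ, Measurable F →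
      planeLp 2 (fun p => Rab α β F p.1 p.2) ≤ ENNReal.ofReal C * circleLp r F) :
    r ≤ 2 := by
  by_contra! hr2
  obtain ⟨C, hC, hb⟩ := hbdd
  set s := r⁻¹.toReal with hs
  have hs0 : 0 ≤ s := ENNReal.toReal_nonneg
  have hs1 : s < 1/2 := by
    have : r⁻¹ < 2⁻¹ := ENNReal.inv_lt_inv.2 hr2
    have := (ENNReal.toReal_lt_toReal (ne_top_of_lt this) (by simp)).2 this
    simpa [hs] using this
  have hcp := cst_pos α β
  have main : ∀ N : ℕ, (N:ℝ) * ((cst α β)^2/2) ≤ C^2 * (N:ℝ) ^ (2*s) := by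
    intro N
    obtain ⟨F, mF, -, bF, qF⟩ := build α β s hs0 (by linarith) hβ0 (by linarith) N
    have h1 := (hb F mF).trans (mul_le_mul_right (norm_upper r hr2 N F bF) _)
    have h2 := pow_le_pow_left₀ (zero_le) h1 2
    rw [planeLp_sq] at h2
    have h3 := qF.trans h2
    rw [← ENNReal.ofReal_mul hC.le, ← ENNReal.ofReal_pow (by positivity), ← ENNReal.ofReal_natCast,
      ← ENNReal.ofReal_mul (by positivity), ENNReal.ofReal_le_ofReal_iff (by positivity)] at h3
    rw [mul_pow, ← Real.rpow_natCast ((N:ℝ)^_), ← Real.rpow_mul (by positivity)] at h3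
    rw [mul_comm 2 s]
    exact_mod_cast h3
  have ht : Tendsto (fun N : ℕ => (N:ℝ) ^ (1 - 2*s)) atTop atTop :=
    (tendsto_rpow_atTop (by linarith)).comp tendsto_natCast_atTop_atTop
  obtain ⟨N, hN, hN0⟩ := ((ht.eventually_gt_atTop (C^2 / ((cst α β)^2/2))).and
    (eventually_gt_atTop 0)).exists
  have hN0' : (0:ℝ) < N := by exact_mod_cast hN0
  have hm := main N
  rw [div_lt_iff₀ (by positivity)] at hN
  have hpos : 0 < (N:ℝ)^(2*s) := by positivity
  have := mul_lt_mul_of_pos_right hN hpos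
  have e : (N:ℝ)^(1-2*s) * (N:ℝ)^(2*s) = N := by
    rw [← Real.rpow_add hN0']; simp
  nlinarith
end
end

section
/- Let 0 ≤ γ < ∞, 0 < q < ∞ and 1 ≤ r ≤ ∞, and assume γ ≥ max{1/q, 2/q − 1/r′, 2/q − 1/2}. Then there is C > 0 such that for every measurable F : ℝ → ℂ there exist measurable g₁, g₂ : ℝ² → ℂ with R*_γF = g₁ + g₂ almost everywhere and ‖g₁‖_{L^{q,∞}_x(L^{q,∞}_y)} + ‖g₂‖_{L^{q,∞}_y(L^{q,∞}_x)} ≤ C · ‖F‖_{L^r(S¹)}. -/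
open MeasureTheory Real Set Filter
open scoped ENNReal

noncomputable section

lemma aux_schur (S : Set ℝ) (hfin : volume S ≠ ⊤)
    (G : ℝ → ℝ) (hG : Measurable G) (A : ℝ) (hA : ∀ φ, ‖G φ‖ ≤ A) (c ε : ℝ) (hc : 0 < c) (hε : 0 < ε) :
    ∫ z, G z.1 ^ 2 * (√(π / ε) * Real.exp (-(c ^ 2 / (4 * ε)) * (z.1 - z.2) ^ 2))
      ∂((volume.restrict S).prod (volume.restrict S)) ≤ 2 * π / c * ∫ φ in S, G φ ^ 2 := by
  have : IsFiniteMeasure (volume.restrict S) := ⟨by simpa using hfin.lt_top⟩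
  have hb : 0 < c ^ 2 / (4 * ε) := by positivity
  have hI : Integrable (fun z : ℝ × ℝ => G z.1 ^ 2 * (√(π / ε) * Real.exp (-(c ^ 2 / (4 * ε)) * (z.1 - z.2) ^ 2)))
      ((volume.restrict S).prod (volume.restrict S)) := by
    refine Integrable.of_bound (C := A ^ 2 * (√(π / ε) * 1)) (by fun_prop) (Eventually.of_forall fun z => ?_)
    rw [norm_mul, norm_pow, norm_mul, Real.norm_of_nonneg (Real.sqrt_nonneg _), Real.norm_of_nonneg (Real.exp_nonneg _)]
    have := hA z.1
    gcongr
    rw [Real.exp_le_one_iff]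
    have := mul_nonneg hb.le (sq_nonneg (z.1 - z.2))
    linarith
  rw [integral_prod _ hI, ← integral_const_mul]
  have hG2 : Integrable (fun φ => G φ ^ 2) (volume.restrict S) := by
    refine Integrable.of_bound (C := A ^ 2) (by fun_prop) (Eventually.of_forall fun z => ?_)
    rw [norm_pow]
    have := hA z
    gcongr
  refine integral_mono hI.integral_prod_left (hG2.const_mul _) fun x => ?_
  simp only
  rw [integral_const_mul, integral_const_mul, mul_comm]
  refine mul_le_mul_of_nonneg_right ?_ (sq_nonneg _)
  have h1 : ∫ y in S, Real.exp (-(c ^ 2 / (4 * ε)) * (x - y) ^ 2) ≤ √(π / (c ^ 2 / (4 * ε))) := by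
    rw [← integral_gaussian, ← integral_sub_left_eq_self (fun y => Real.exp (-(c ^ 2 / (4 * ε)) * y ^ 2)) volume x]
    exact setIntegral_le_integral ((integrable_exp_neg_mul_sq hb).comp_sub_left x)
      (Eventually.of_forall fun y => Real.exp_nonneg _)
  calc _ ≤ √(π / ε) * √(π / (c ^ 2 / (4 * ε))) := by gcongr
    _ = √((2 * π / c) ^ 2) := by
      rw [← Real.sqrt_mul (by positivity)]
      congr 1
      field_simp
      ring
    _ = _ := Real.sqrt_sq (by positivity)

lemma aux_gauss (ε w : ℝ) (hε : 0 < ε) :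
    ∫ y : ℝ, Complex.exp (Complex.I * (y * w : ℝ)) * ((Real.exp (-ε * y ^ 2) : ℝ) : ℂ) =
      ((√(π / ε) * Real.exp (-(w ^ 2 / (4 * ε))) : ℝ) : ℂ) := by
  have h := fourierIntegral_gaussian (b := (ε : ℂ)) (by simpa using hε) (w : ℂ)
  have e : ((√(π / ε) * Real.exp (-(w ^ 2 / (4 * ε))) : ℝ) : ℂ) =
      (↑Real.pi / (ε : ℂ)) ^ (1 / 2 : ℂ) * Complex.exp (-(w : ℂ) ^ 2 / (4 * ε)) := by
    rw [Real.sqrt_eq_rpow]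
    push_cast
    rw [Complex.ofReal_cpow (by positivity)]
    push_cast
    rw [neg_div]
  rw [e, ← h]
  congr 1
  ext y
  push_cast
  congr 2
  ring

lemma aux_L2 (S : Set ℝ) (hS : MeasurableSet S) (hfin : volume S ≠ ⊤)
    (G : ℝ → ℂ) (hG : Measurable G) (A : ℝ) (hA : ∀ φ, ‖G φ‖ ≤ A)
    (θ : ℝ → ℝ) (hθ : Measurable θ) (c ε : ℝ) (hc : 0 < c) (hε : 0 < ε)
    (hsep : ∀ φ ∈ S, ∀ ψ ∈ S, c * |φ - ψ| ≤ |θ φ - θ ψ|) :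
    ∫ y : ℝ, ‖∫ φ in S, G φ * Complex.exp (Complex.I * (y * θ φ : ℝ))‖ ^ 2 * Real.exp (-ε * y ^ 2)
      ≤ 2 * π / c * ∫ φ in S, ‖G φ‖ ^ 2 := by
  have : IsFiniteMeasure (volume.restrict S) := ⟨by simpa using hfin.lt_top⟩
  set μ := volume.restrict S with hμ
  let f : ℝ → ℝ × ℝ → ℂ := fun y z =>
    G z.1 * (starRingEnd ℂ) (G z.2) * (Complex.exp (Complex.I * (y * (θ z.1 - θ z.2) : ℝ)) *
      ((Real.exp (-ε * y ^ 2) : ℝ) : ℂ))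
  have hn : ∀ a : ℝ, ‖Complex.exp (Complex.I * (a : ℂ))‖ = 1 := fun a => by
    rw [mul_comm]; exact Complex.norm_exp_ofReal_mul_I a
  have hcG : Measurable fun φ => (starRingEnd ℂ) (G φ) := Complex.continuous_conj.measurable.comp hG
  have hfi : Integrable (Function.uncurry f) (volume.prod (μ.prod μ)) := by
    have h1 : Integrable (fun p : ℝ × (ℝ × ℝ) => Real.exp (-ε * p.1 ^ 2) * (A ^ 2)) (volume.prod (μ.prod μ)) :=
      Integrable.mul_prod (integrable_exp_neg_mul_sq hε) (integrable_const _)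
    refine h1.mono' ?_ (Eventually.of_forall fun p => ?_)
    · have : Measurable (Function.uncurry f) := by
        simp only [Function.uncurry_def, f]
        have a1 : Measurable fun p : ℝ × (ℝ × ℝ) => (starRingEnd ℂ) (G p.2.2) := hcG.comp (by fun_prop)
        fun_prop
      exact this.aestronglyMeasurable
    · simp only [Function.uncurry_def, f]
      rw [norm_mul, norm_mul, norm_mul, hn, RCLike.norm_conj, Complex.norm_real, Real.norm_of_nonneg (Real.exp_nonneg _),
        one_mul, mul_comm]
      have := hA p.2.1
      have := hA p.2.2
      have := (norm_nonneg _).trans this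
      have h9 : ‖G p.2.1‖ * ‖G p.2.2‖ ≤ A ^ 2 := by
        rw [sq]; gcongr
      gcongr
  have h1 : ∀ y : ℝ, ((‖∫ φ in S, G φ * Complex.exp (Complex.I * (y * θ φ : ℝ))‖ ^ 2 * Real.exp (-ε * y ^ 2) : ℝ) : ℂ)
      = ∫ z, f y z ∂(μ.prod μ) := by
    intro y
    rw [Complex.ofReal_mul, Complex.ofReal_pow, ← Complex.mul_conj', ← integral_conj, ← integral_prod_mul, ← integral_mul_const]
    congr 1
    ext z
    simp only [f, map_mul, ← Complex.exp_conj, Complex.conj_I, Complex.conj_ofReal]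
    have : Complex.exp (Complex.I * (y * (θ z.1 - θ z.2) : ℝ)) =
      Complex.exp (Complex.I * (y * θ z.1 : ℝ)) * Complex.exp (-Complex.I * (y * θ z.2 : ℝ)) := by
      rw [← Complex.exp_add]; congr 1; push_cast; ring
    rw [this]; ring
  have h2 : ((∫ y : ℝ, ‖∫ φ in S, G φ * Complex.exp (Complex.I * (y * θ φ : ℝ))‖ ^ 2 * Real.exp (-ε * y ^ 2) : ℝ) : ℂ)
      = ∫ z, G z.1 * (starRingEnd ℂ) (G z.2) * ((√(π / ε) * Real.exp (-((θ z.1 - θ z.2) ^ 2 / (4 * ε))) : ℝ) : ℂ) ∂(μ.prod μ) := by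
    rw [← integral_complex_ofReal]
    simp_rw [h1]
    rw [integral_integral_swap hfi]
    congr 1
    ext z
    simp only [f]
    rw [integral_const_mul, aux_gauss _ _ hε]
  have h0 : 0 ≤ ∫ y : ℝ, ‖∫ φ in S, G φ * Complex.exp (Complex.I * (y * θ φ : ℝ))‖ ^ 2 * Real.exp (-ε * y ^ 2) :=
    integral_nonneg fun y => by positivity
  rw [← Complex.norm_of_nonneg h0, h2]
  let κ : ℝ × ℝ → ℝ := fun z => √(π / ε) * Real.exp (-(c ^ 2 / (4 * ε)) * (z.1 - z.2) ^ 2)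
  have hκm : Measurable κ := by fun_prop
  have hκ0 : ∀ z, 0 ≤ κ z := fun z => by positivity
  have hκ1 : ∀ z, κ z ≤ √(π / ε) := fun z => by
    refine mul_le_of_le_one_right (Real.sqrt_nonneg _) ?_
    rw [Real.exp_le_one_iff]
    have := mul_nonneg (by positivity : 0 ≤ c ^ 2 / (4 * ε)) (sq_nonneg (z.1 - z.2))
    linarith
  have hi1 : Integrable (fun z : ℝ × ℝ => ‖G z.1‖ ^ 2 * κ z) (μ.prod μ) := by
    refine Integrable.of_bound (C := A ^ 2 * √(π / ε)) (by fun_prop) (Eventually.of_forall fun z => ?_)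
    rw [Real.norm_of_nonneg (mul_nonneg (by positivity) (hκ0 z))]
    have := hA z.1
    have := hκ1 z
    have := hκ0 z
    gcongr
  have hs : ∀ z : ℝ × ℝ, κ z.swap = κ z := fun z => by
    simp only [κ, Prod.fst_swap, Prod.snd_swap]
    congr 3; ring
  have hi2 : Integrable (fun z : ℝ × ℝ => ‖G z.2‖ ^ 2 * κ z) (μ.prod μ) := by
    have := hi1.swap
    refine this.congr (Eventually.of_forall fun z => ?_)
    simp [hs]
  have he : ∫ z, ‖G z.2‖ ^ 2 * κ z ∂(μ.prod μ) = ∫ z, ‖G z.1‖ ^ 2 * κ z ∂(μ.prod μ) := by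
    rw [← integral_prod_swap]
    simp [hs]
  have hsch := aux_schur S hfin (fun φ => ‖G φ‖) hG.norm A (by simpa using hA) c ε hc hε
  refine le_trans ?_ hsch
  have hae : ∀ᵐ z ∂(μ.prod μ), z.1 ∈ S ∧ z.2 ∈ S := by
    rw [hμ, Measure.prod_restrict]
    filter_upwards [ae_restrict_mem (hS.prod hS)] with z hz using hz
  calc _ ≤ ∫ z, (‖G z.1‖ ^ 2 * κ z + ‖G z.2‖ ^ 2 * κ z) / 2 ∂(μ.prod μ) := by
        refine norm_integral_le_of_norm_le ((hi1.add hi2).div_const 2) ?_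
        filter_upwards [hae] with z hz
        rw [norm_mul, norm_mul, RCLike.norm_conj, Complex.norm_real, Real.norm_of_nonneg (by positivity)]
        have hk : √(π / ε) * Real.exp (-((θ z.1 - θ z.2) ^ 2 / (4 * ε))) ≤ κ z := by
          have h3 := hsep _ hz.1 _ hz.2
          have h4 : c ^ 2 * (z.1 - z.2) ^ 2 ≤ (θ z.1 - θ z.2) ^ 2 := by
            rw [← mul_pow, ← sq_abs, ← sq_abs (θ z.1 - θ z.2), abs_mul, abs_of_pos hc]
            gcongr
          simp only [κ]
          gcongr
          rw [neg_mul, neg_le_neg_iff, div_mul_eq_mul_div]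
          gcongr
        have h5 : ‖G z.1‖ * ‖G z.2‖ ≤ (‖G z.1‖ ^ 2 + ‖G z.2‖ ^ 2) / 2 := by
          nlinarith [sq_nonneg (‖G z.1‖ - ‖G z.2‖)]
        calc _ ≤ ((‖G z.1‖ ^ 2 + ‖G z.2‖ ^ 2) / 2) * κ z := by gcongr
          _ = _ := by ring
    _ = _ := by
        rw [integral_div, integral_add hi1 hi2, he]
        simp only [κ, hμ]
        ring

lemma aux_weak2 (S : Set ℝ) (hS : MeasurableSet S) (hfin : volume S ≠ ⊤)
    (G : ℝ → ℂ) (hG : Measurable G) (A : ℝ) (hA : ∀ φ, ‖G φ‖ ≤ A)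
    (θ : ℝ → ℝ) (hθ : Measurable θ) (c : ℝ) (hc : 0 < c)
    (hsep : ∀ φ ∈ S, ∀ ψ ∈ S, c * |φ - ψ| ≤ |θ φ - θ ψ|) (t : ℝ) (ht : 0 < t) :
    volume {y : ℝ | t < ‖∫ φ in S, G φ * Complex.exp (Complex.I * (y * θ φ : ℝ))‖}
      ≤ ENNReal.ofReal (2 * π / c * Real.exp 1 * (∫ φ in S, ‖G φ‖ ^ 2) / t ^ 2) := by
  have : IsFiniteMeasure (volume.restrict S) := ⟨by simpa using hfin.lt_top⟩
  set h : ℝ → ℂ := fun y => ∫ φ in S, G φ * Complex.exp (Complex.I * (y * θ φ : ℝ)) with hh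
  have hhm : StronglyMeasurable h := by
    apply StronglyMeasurable.integral_prod_right
    apply Measurable.stronglyMeasurable
    simp only [Function.uncurry_def]
    fun_prop
  have hn : ∀ a : ℝ, ‖Complex.exp (Complex.I * (a : ℂ))‖ = 1 := fun a => by
    rw [mul_comm]; exact Complex.norm_exp_ofReal_mul_I a
  have hhb : ∀ y, ‖h y‖ ≤ A * (volume.restrict S).real univ := fun y => by
    refine norm_integral_le_of_norm_le_const (Eventually.of_forall fun φ => ?_)
    rw [norm_mul, hn, mul_one]; exact hA φ
  have hmono : Monotone fun n : ℕ => {y : ℝ | t < ‖h y‖} ∩ Icc (-(n + 1 : ℝ)) (n + 1) := by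
    intro m n hmn
    have : (m : ℝ) ≤ n := by exact_mod_cast hmn
    exact inter_subset_inter_right _ (Icc_subset_Icc (by linarith) (by linarith))
  have hU : {y : ℝ | t < ‖h y‖} = ⋃ n : ℕ, {y : ℝ | t < ‖h y‖} ∩ Icc (-(n + 1 : ℝ)) (n + 1) := by
    rw [← inter_iUnion]
    symm
    apply inter_eq_left.2
    intro y _
    obtain ⟨n, hn⟩ := exists_nat_ge |y|
    exact mem_iUnion.2 ⟨n, by have := abs_le.1 hn; constructor <;> linarith⟩
  rw [hU, hmono.measure_iUnion]
  refine iSup_le fun n => ?_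
  set ε : ℝ := 1 / (n + 1 : ℝ) ^ 2 with hε'
  have hε : 0 < ε := by positivity
  have hL := aux_L2 S hS hfin G hG A hA θ hθ c ε hc hε hsep
  have hint : Integrable (fun y => ‖h y‖ ^ 2 * Real.exp (-ε * y ^ 2)) := by
    refine ((integrable_exp_neg_mul_sq hε).const_mul ((A * (volume.restrict S).real univ) ^ 2)).mono' ?_
      (Eventually.of_forall fun y => ?_)
    · exact ((hhm.norm.measurable.pow_const 2).mul (by fun_prop)).aestronglyMeasurable
    · rw [Real.norm_of_nonneg (by positivity)]
      have := hhb y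
      gcongr
  have hch := mul_meas_ge_le_integral_of_nonneg (μ := volume)
    (Eventually.of_forall fun y => by positivity) hint (t ^ 2 * Real.exp (-1))
  have hfinm : volume {y : ℝ | t ^ 2 * Real.exp (-1) ≤ ‖h y‖ ^ 2 * Real.exp (-ε * y ^ 2)} ≠ ⊤ :=
    (hint.measure_ge_lt_top (by positivity)).ne
  have hsub : {y : ℝ | t < ‖h y‖} ∩ Icc (-(n + 1 : ℝ)) (n + 1) ⊆
      {y : ℝ | t ^ 2 * Real.exp (-1) ≤ ‖h y‖ ^ 2 * Real.exp (-ε * y ^ 2)} := by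
    rintro y ⟨hy, hy1, hy2⟩
    simp only [mem_ofPred_eq] at hy ⊢
    gcongr
    have : y ^ 2 ≤ (n + 1 : ℝ) ^ 2 := by nlinarith
    rw [neg_mul, neg_le_neg_iff, hε', one_div_mul_eq_div]
    exact (div_le_one (by positivity)).2 this
  refine (measure_mono hsub).trans ?_
  rw [← ENNReal.ofReal_toReal hfinm]
  apply ENNReal.ofReal_le_ofReal
  rw [le_div_iff₀ (by positivity)]
  have h6 := hch.trans hL
  rw [Measure.real, Real.exp_neg] at h6
  have he : 0 < Real.exp 1 := Real.exp_pos 1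
  calc _ = Real.exp 1 * (t ^ 2 * (Real.exp 1)⁻¹ * (volume {y : ℝ | t ^ 2 * Real.exp (-1) ≤ ‖h y‖ ^ 2 * Real.exp (-ε * y ^ 2)}).toReal) := by
        field_simp
    _ ≤ Real.exp 1 * (2 * π / c * ∫ φ in S, ‖G φ‖ ^ 2) := by
        rw [Real.exp_neg]
        exact mul_le_mul_of_nonneg_left h6 he.le
    _ = _ := by ring

lemma aux_K (S : Set ℝ) (hS : MeasurableSet S) (hfin : volume S ≠ ⊤)
    (F : ℝ → ℂ) (hF : Measurable F) (hFi : IntegrableOn F S)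
    (ω θ : ℝ → ℝ) (hω : Measurable ω) (hθ : Measurable θ) (c : ℝ) (hc : 0 < c)
    (hsep : ∀ φ ∈ S, ∀ ψ ∈ S, c * |φ - ψ| ≤ |θ φ - θ ψ|)
    (u : ℝ) (hu0 : 0 ≤ u) (hu1 : u ≤ 1 / 2) (N : ℝ) (hN : 0 < N)
    (hpi : IntegrableOn (fun φ => ‖F φ‖ ^ (1 / (1 - u))) S)
    (hpN : ∫ φ in S, ‖F φ‖ ^ (1 / (1 - u)) ≤ N ^ (1 / (1 - u)))
    (τ : ℝ) (hτ : 0 < τ) :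
    volume {y : ℝ | 2 * N * τ ^ u < ‖∫ φ in S, F φ * Complex.exp (Complex.I * (ω φ + y * θ φ : ℝ))‖}
      ≤ ENNReal.ofReal (2 * π / c * Real.exp 1 / τ) := by
  have h1u : 0 < 1 - u := by linarith
  set p := 1 / (1 - u) with hp
  have hp1 : 1 ≤ p := by rw [hp, le_div_iff₀ h1u]; linarith
  have hp2 : p ≤ 2 := by rw [hp, div_le_iff₀ h1u]; linarith
  have hpu : (1 - u) * p = 1 := by rw [hp]; field_simp
  set A := N * τ ^ (-(1 - u)) with hA
  have hA0 : 0 < A := by positivity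
  have hA1 : A ^ (1 - p) * N ^ p = N * τ ^ u := by
    rw [hA, Real.mul_rpow hN.le (by positivity), ← Real.rpow_mul hτ.le,
      show -(1 - u) * (1 - p) = u by linarith]
    rw [mul_right_comm, ← Real.rpow_add hN, show 1 - p + p = 1 by ring, Real.rpow_one]
  have hA2 : A ^ (2 - p) * N ^ p = N ^ 2 * (τ ^ u) ^ 2 / τ := by
    rw [hA, Real.mul_rpow hN.le (by positivity), ← Real.rpow_mul hτ.le,
      show -(1 - u) * (2 - p) = u + u - 1 by linarith]
    rw [mul_right_comm, ← Real.rpow_add hN, show 2 - p + p = 2 by ring, Real.rpow_sub hτ,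
      Real.rpow_add hτ, Real.rpow_one, Real.rpow_two]
    ring
  let T : Set ℝ := {φ | ‖F φ‖ ≤ A}
  have hT : MeasurableSet T := measurableSet_le hF.norm measurable_const
  have hn : ∀ a : ℝ, ‖Complex.exp (Complex.I * (a : ℂ))‖ = 1 := fun a => by
    rw [mul_comm]; exact Complex.norm_exp_ofReal_mul_I a
  let G : ℝ → ℂ := fun φ => T.indicator F φ * Complex.exp (Complex.I * (ω φ : ℝ))
  have hTF : Measurable (T.indicator F) := hF.indicator hT
  have hTF' : Measurable (Tᶜ.indicator F) := hF.indicator hT.compl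
  have hGm : Measurable G := by
    simp only [G]; fun_prop
  have hGn : ∀ φ, ‖G φ‖ = ‖T.indicator F φ‖ := fun φ => by
    simp only [G]; rw [norm_mul, hn, mul_one]
  have hGA : ∀ φ, ‖G φ‖ ≤ A := fun φ => by
    rw [hGn]
    by_cases h : φ ∈ T
    · rw [indicator_of_mem h]; exact h
    · rw [indicator_of_notMem h, norm_zero]; exact hA0.le
  have hw := aux_weak2 S hS hfin G hGm A hGA θ hθ c hc hsep (N * τ ^ u) (by positivity)
  have hG2 : ∫ φ in S, ‖G φ‖ ^ 2 ≤ N ^ 2 * (τ ^ u) ^ 2 / τ := by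
    rw [← hA2]
    calc _ ≤ ∫ φ in S, A ^ (2 - p) * ‖F φ‖ ^ p := by
          refine integral_mono_of_nonneg (Eventually.of_forall fun φ => by positivity) (hpi.const_mul _)
            (Eventually.of_forall fun φ => ?_)
          simp only
          rw [hGn]
          by_cases h : φ ∈ T
          · rw [indicator_of_mem h]
            rcases eq_or_lt_of_le (norm_nonneg (F φ)) with h0 | h0
            · rw [← h0, Real.zero_rpow (by linarith)]; simp
            · calc ‖F φ‖ ^ 2 = ‖F φ‖ ^ (2 - p) * ‖F φ‖ ^ p := by
                    rw [← Real.rpow_add h0, show 2 - p + p = 2 by ring, Real.rpow_two]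
                _ ≤ _ := by
                    have h' : ‖F φ‖ ≤ A := h
                    have : 0 ≤ 2 - p := by linarith
                    gcongr
          · rw [indicator_of_notMem h, norm_zero, zero_pow two_ne_zero]; positivity
      _ ≤ _ := by
          rw [integral_const_mul]; gcongr
  have hgt : ∫ φ in S, ‖Tᶜ.indicator F φ‖ ≤ N * τ ^ u := by
    rw [← hA1]
    calc _ ≤ ∫ φ in S, A ^ (1 - p) * ‖F φ‖ ^ p := by
          refine integral_mono_of_nonneg (Eventually.of_forall fun φ => norm_nonneg _) (hpi.const_mul _)
            (Eventually.of_forall fun φ => ?_)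
          simp only
          by_cases h : φ ∈ Tᶜ
          · rw [indicator_of_mem h]
            have h' : A < ‖F φ‖ := not_le.1 h
            have h0 := hA0.trans h'
            calc ‖F φ‖ = ‖F φ‖ ^ (1 - p) * ‖F φ‖ ^ p := by
                    rw [← Real.rpow_add h0, show 1 - p + p = 1 by ring, Real.rpow_one]
                _ ≤ _ := by
                    gcongr ?_ * _
                    exact Real.rpow_le_rpow_of_nonpos hA0 h'.le (by linarith)
          · rw [indicator_of_notMem h, norm_zero]; positivity
      _ ≤ _ := by
          rw [integral_const_mul]; gcongr
  refine (measure_mono ?_).trans (hw.trans (ENNReal.ofReal_le_ofReal ?_))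
  · intro y hy
    simp only [mem_ofPred_eq] at hy ⊢
    have e1 : ∀ φ, F φ * Complex.exp (Complex.I * (ω φ + y * θ φ : ℝ)) =
        G φ * Complex.exp (Complex.I * (y * θ φ : ℝ)) +
        Tᶜ.indicator F φ * Complex.exp (Complex.I * (ω φ + y * θ φ : ℝ)) := fun φ => by
      have : Complex.exp (Complex.I * (ω φ + y * θ φ : ℝ)) =
          Complex.exp (Complex.I * (ω φ : ℝ)) * Complex.exp (Complex.I * (y * θ φ : ℝ)) := by
        rw [← Complex.exp_add]; congr 1; push_cast; ring
      simp only [G]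
      rw [mul_assoc, ← this, ← add_mul]
      congr 1
      exact (congrFun (indicator_self_add_compl T F) φ).symm
    have i1 : IntegrableOn (fun φ => G φ * Complex.exp (Complex.I * (y * θ φ : ℝ))) S := by
      refine Integrable.mono' (hFi.norm) (by fun_prop) (Eventually.of_forall fun φ => ?_)
      rw [norm_mul, hn, mul_one, hGn]
      exact norm_indicator_le_norm_self _ _
    have i2 : IntegrableOn (fun φ => Tᶜ.indicator F φ * Complex.exp (Complex.I * (ω φ + y * θ φ : ℝ))) S := by
      refine Integrable.mono' (hFi.norm) (by fun_prop) (Eventually.of_forall fun φ => ?_)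
      rw [norm_mul, hn, mul_one]
      exact norm_indicator_le_norm_self _ _
    simp_rw [e1] at hy
    rw [integral_add i1 i2] at hy
    have b2 : ‖∫ φ in S, Tᶜ.indicator F φ * Complex.exp (Complex.I * (ω φ + y * θ φ : ℝ))‖ ≤ N * τ ^ u := by
      refine (norm_integral_le_integral_norm _).trans (le_trans (le_of_eq ?_) hgt)
      simp_rw [norm_mul, hn, mul_one]
    have := norm_add_le (∫ φ in S, G φ * Complex.exp (Complex.I * (y * θ φ : ℝ)))
      (∫ φ in S, Tᶜ.indicator F φ * Complex.exp (Complex.I * (ω φ + y * θ φ : ℝ)))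
    linarith
  · have : 0 < τ ^ u := by positivity
    calc _ ≤ 2 * π / c * Real.exp 1 * (N ^ 2 * (τ ^ u) ^ 2 / τ) / (N * τ ^ u) ^ 2 := by gcongr
      _ = _ := by field_simp

lemma vol_abs (R : ℝ) : volume {y : ℝ | 1 + |y| < R} ≤ ENNReal.ofReal (2 * R) := by
  refine (measure_mono (t := Icc (-R) R) fun y hy => ?_).trans (by rw [Real.volume_Icc]; exact ENNReal.ofReal_le_ofReal (by linarith))
  simp only [mem_ofPred_eq] at hy
  exact abs_le.1 (by linarith)

lemma aux_mixed (q u γ B D : ℝ) (hq : 0 < q) (huq : u ≤ 1 / q) (hγ : 2 / q - u ≤ γ)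
    (hB : 0 < B) (hD : 0 < D) (M : ℝ → ℝ → ℂ) (w : ℝ → ℝ → ℂ)
    (hw : ∀ x y, ‖w x y‖ = (1 + |x| + |y|) ^ (-γ))
    (hM : ∀ x τ, 0 < τ → volume {y : ℝ | B * τ ^ u < ‖M x y‖} ≤ ENNReal.ofReal (D / τ)) :
    wlineE q (fun x => wline q (fun y => M x y * w x y)) ≤ ENNReal.ofReal (B * (2 * (D + 2)) ^ (1 / q)) := by
  set v := 1 / q - u with hv
  have hv0 : 0 ≤ v := by linarith
  have hqi : 0 < 1 / q := by positivity
  have hw' : ∀ x y, ‖w x y‖ ≤ (1 + |x|) ^ (-(1 / q)) * (1 + |y|) ^ (-v) := by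
    intro x y
    have hx := abs_nonneg x
    have hy := abs_nonneg y
    rw [hw]
    calc _ ≤ (1 + |x| + |y|) ^ (-(1 / q) + -v) := by
          apply Real.rpow_le_rpow_of_exponent_le (by linarith)
          have : 2 / q = 1 / q + 1 / q := by ring
          linarith
      _ = (1 + |x| + |y|) ^ (-(1 / q)) * (1 + |x| + |y|) ^ (-v) := Real.rpow_add (by linarith) _ _
      _ ≤ _ := by
          gcongr ?_ * ?_
          · exact Real.rpow_le_rpow_of_nonpos (by linarith) (by linarith) (by linarith)
          · exact Real.rpow_le_rpow_of_nonpos (by linarith) (by linarith) (by linarith)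
  have hin : ∀ x, wline q (fun y => M x y * w x y) ≤
      ENNReal.ofReal (B * (D + 2) ^ (1 / q) * (1 + |x|) ^ (-(1 / q))) := by
    intro x
    have hx : 0 < 1 + |x| := by have := abs_nonneg x; linarith
    refine iSup₂_le fun t ht => ?_
    obtain ⟨τ, hτ, htτ⟩ : ∃ τ : ℝ, 0 < τ ∧ t = B * (1 + |x|) ^ (-(1 / q)) * τ ^ (1 / q) := by
      refine ⟨(t / (B * (1 + |x|) ^ (-(1 / q)))) ^ q, by positivity, ?_⟩
      rw [← Real.rpow_mul (by positivity), mul_one_div_cancel hq.ne', Real.rpow_one]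
      field_simp
    have hvol : volume {y : ℝ | t < ‖M x y * w x y‖} ≤ ENNReal.ofReal ((D + 2) / τ) := by
      have hsub : {y : ℝ | t < ‖M x y * w x y‖} ⊆
          {y : ℝ | B * τ ^ u < ‖M x y‖} ∪ {y : ℝ | 1 + |y| < 1 / τ} := by
        intro y hy
        by_contra hcon
        simp only [mem_union, mem_ofPred_eq, not_or, not_lt] at hcon hy
        obtain ⟨h1, h2⟩ := hcon
        have h3 : (1 + |y|) ^ (-v) ≤ τ ^ v := by
          calc _ ≤ (1 / τ) ^ (-v) := Real.rpow_le_rpow_of_nonpos (by positivity) h2 (by linarith)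
            _ = _ := by rw [one_div, Real.inv_rpow hτ.le, Real.rpow_neg hτ.le, inv_inv]
        have : ‖M x y * w x y‖ ≤ t := by
          rw [norm_mul]
          calc _ ≤ (B * τ ^ u) * ((1 + |x|) ^ (-(1 / q)) * τ ^ v) := by
                gcongr
                exact (hw' x y).trans (by gcongr)
            _ = B * (1 + |x|) ^ (-(1 / q)) * (τ ^ u * τ ^ v) := by ring
            _ = t := by rw [← Real.rpow_add hτ, htτ, hv]; congr 2; ring
        linarith
      refine (measure_mono hsub).trans ((measure_union_le _ _).trans ((add_le_add (hM x τ hτ) (vol_abs _)).trans ?_))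
      rw [← ENNReal.ofReal_add (by positivity) (by positivity)]
      apply le_of_eq
      congr 1
      ring
    calc _ ≤ ENNReal.ofReal t * ENNReal.ofReal ((D + 2) / τ) ^ (1 / q) := by gcongr
      _ = ENNReal.ofReal (t * ((D + 2) / τ) ^ (1 / q)) := by
          rw [ENNReal.ofReal_rpow_of_nonneg (by positivity) hqi.le, ← ENNReal.ofReal_mul ht.le]
      _ = _ := by
          congr 1
          rw [Real.div_rpow (by positivity) hτ.le, htτ]
          have : 0 < τ ^ (1 / q) := by positivity
          field_simp
  refine iSup₂_le fun t ht => ?_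
  set B' := B * (D + 2) ^ (1 / q) with hB'
  have hB'0 : 0 < B' := by positivity
  have hvol : volume {x : ℝ | ENNReal.ofReal t < wline q (fun y => M x y * w x y)} ≤
      ENNReal.ofReal (2 * (B' / t) ^ q) := by
    refine (measure_mono fun x hx => ?_).trans (vol_abs _)
    simp only [mem_ofPred_eq] at hx ⊢
    have hx0 : 0 < 1 + |x| := by have := abs_nonneg x; linarith
    have h1 := (ENNReal.ofReal_lt_ofReal_iff (by positivity)).1 (hx.trans_le (hin x))
    rw [Real.rpow_neg hx0.le, ← div_eq_mul_inv, lt_div_iff₀ (by positivity)] at h1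
    have h2 : (1 + |x|) ^ (1 / q) < B' / t := by rw [lt_div_iff₀ ht]; linarith
    calc 1 + |x| = ((1 + |x|) ^ (1 / q)) ^ q := by
          rw [← Real.rpow_mul hx0.le, one_div_mul_cancel hq.ne', Real.rpow_one]
      _ < _ := by gcongr
  calc _ ≤ ENNReal.ofReal t * ENNReal.ofReal (2 * (B' / t) ^ q) ^ (1 / q) := by gcongr
    _ = ENNReal.ofReal (t * (2 * (B' / t) ^ q) ^ (1 / q)) := by
        rw [ENNReal.ofReal_rpow_of_nonneg (by positivity) hqi.le, ← ENNReal.ofReal_mul ht.le]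
    _ = _ := by
        congr 1
        rw [Real.mul_rpow (by norm_num) (by positivity), ← Real.rpow_mul (by positivity), mul_one_div_cancel hq.ne',
          Real.rpow_one, Real.mul_rpow (by norm_num) (by positivity), hB']
        field_simp

lemma sep_aux (φ ψ k : ℝ) (hd : |φ - ψ| ≤ π / 2) (hk : 1 / 2 ≤ |k|) :
    1 / π * |φ - ψ| ≤ |2 * Real.sin ((φ - ψ) / 2) * k| := by
  have h1 : 2 / π * (|φ - ψ| / 2) ≤ |Real.sin ((φ - ψ) / 2)| := by
    have h2 := Real.mul_le_sin (x := |φ - ψ| / 2) (by positivity) (by linarith [Real.pi_pos])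
    refine h2.trans ?_
    rcases abs_cases (φ - ψ) with ⟨h, _⟩ | ⟨h, _⟩ <;> rw [h]
    · exact le_abs_self _
    · rw [neg_div, Real.sin_neg]; exact neg_le_abs _
  rw [abs_mul, abs_mul, abs_two]
  calc _ = 2 * (2 / π * (|φ - ψ| / 2)) * (1 / 2) := by ring
    _ ≤ _ := by gcongr

lemma cos_half (m : ℝ) (h1 : -(π / 4) ≤ m) (h2 : m ≤ π / 4) : 1 / 2 ≤ Real.cos m := by
  rw [← Real.cos_pi_div_three]
  have := Real.pi_pos
  rw [← Real.cos_abs m]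
  exact Real.cos_le_cos_of_nonneg_of_le_pi (abs_nonneg _) (by linarith) (abs_le.2 ⟨by linarith, by linarith⟩ |>.trans (by linarith : π / 4 ≤ π / 3))

lemma sep_sin (a b : ℝ) (hab : b - a ≤ π / 2) (hk : ∀ m ∈ Icc a b, 1 / 2 ≤ |Real.cos m|) :
    ∀ φ ∈ Ioc a b, ∀ ψ ∈ Ioc a b, 1 / π * |φ - ψ| ≤ |Real.sin φ - Real.sin ψ| := by
  rintro φ ⟨h1, h2⟩ ψ ⟨h3, h4⟩
  rw [Real.sin_sub_sin]
  exact sep_aux _ _ _ (abs_le.2 ⟨by linarith, by linarith⟩) (hk _ ⟨by linarith, by linarith⟩)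

lemma sep_cos (a b : ℝ) (hab : b - a ≤ π / 2) (hk : ∀ m ∈ Icc a b, 1 / 2 ≤ |Real.sin m|) :
    ∀ φ ∈ Ioc a b, ∀ ψ ∈ Ioc a b, 1 / π * |φ - ψ| ≤ |Real.cos φ - Real.cos ψ| := by
  rintro φ ⟨h1, h2⟩ ψ ⟨h3, h4⟩
  rw [Real.cos_sub_cos]
  have := sep_aux φ ψ (Real.sin ((φ + ψ) / 2)) (abs_le.2 ⟨by linarith, by linarith⟩) (hk _ ⟨by linarith, by linarith⟩)
  rw [show -2 * Real.sin ((φ + ψ) / 2) * Real.sin ((φ - ψ) / 2) =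
    -(2 * Real.sin ((φ - ψ) / 2) * Real.sin ((φ + ψ) / 2)) by ring, abs_neg]
  exact this

def Ppiece (F : ℝ → ℂ) (S : Set ℝ) (x y : ℝ) : ℂ :=
  ∫ φ in S, F φ * Complex.exp (Complex.I * Complex.ofReal (x * Real.cos φ + y * Real.sin φ))

lemma Ppiece_meas (F : ℝ → ℂ) (hF : Measurable F) (S : Set ℝ) :
    Measurable fun p : ℝ × ℝ => Ppiece F S p.1 p.2 := by
  apply StronglyMeasurable.measurable
  apply StronglyMeasurable.integral_prod_right
  apply Measurable.stronglyMeasurable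
  simp only [Function.uncurry_def]
  fun_prop

lemma aux_three (h₁ h₂ h₃ : ℝ → ℂ) (b d : ℝ) (hd : 0 ≤ d)
    (H₁ : volume {y : ℝ | b < ‖h₁ y‖} ≤ ENNReal.ofReal d)
    (H₂ : volume {y : ℝ | b < ‖h₂ y‖} ≤ ENNReal.ofReal d)
    (H₃ : volume {y : ℝ | b < ‖h₃ y‖} ≤ ENNReal.ofReal d) :
    volume {y : ℝ | 3 * b < ‖Complex.ofReal (1 / (2 * π)) * (h₁ y + h₂ y + h₃ y)‖} ≤ ENNReal.ofReal (3 * d) := by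
  have hsub : {y : ℝ | 3 * b < ‖Complex.ofReal (1 / (2 * π)) * (h₁ y + h₂ y + h₃ y)‖} ⊆
      {y : ℝ | b < ‖h₁ y‖} ∪ {y : ℝ | b < ‖h₂ y‖} ∪ {y : ℝ | b < ‖h₃ y‖} := by
    intro y hy
    by_contra hcon
    simp only [mem_union, mem_ofPred_eq, not_or, not_lt] at hcon hy
    obtain ⟨⟨a1, a2⟩, a3⟩ := hcon
    have h1 : ‖Complex.ofReal (1 / (2 * π))‖ ≤ 1 := by
      rw [Complex.norm_real, Real.norm_of_nonneg (by positivity), div_le_one (by positivity)]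
      linarith [Real.pi_gt_three]
    have h2 : ‖h₁ y + h₂ y + h₃ y‖ ≤ ‖h₁ y‖ + ‖h₂ y‖ + ‖h₃ y‖ := norm_add₃_le
    rw [norm_mul] at hy
    have := mul_le_of_le_one_left (norm_nonneg (h₁ y + h₂ y + h₃ y)) h1
    linarith
  refine (measure_mono hsub).trans ((measure_union_le _ _).trans
    ((add_le_add ((measure_union_le _ _).trans (add_le_add H₁ H₂)) H₃).trans ?_))
  rw [← ENNReal.ofReal_add hd hd, ← ENNReal.ofReal_add (by positivity) hd]
  apply le_of_eq
  congr 1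
  ring

lemma Rext_split (F : ℝ → ℂ) (hF : IntegrableOn F (Ioc 0 (2 * π))) (x y : ℝ) :
    Rext F x y = Complex.ofReal (1 / (2 * π)) * (Ppiece F (Ioc 0 (π / 4)) x y +
      Ppiece F (Ioc (3 * π / 4) (5 * π / 4)) x y + Ppiece F (Ioc (7 * π / 4) (2 * π)) x y) +
      Complex.ofReal (1 / (2 * π)) * (Ppiece F (Ioc (π / 4) (3 * π / 4)) x y +
      Ppiece F (Ioc (5 * π / 4) (7 * π / 4)) x y + Ppiece F ∅ x y) := by
  have hpi := Real.pi_pos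
  have hn : ∀ a : ℝ, ‖Complex.exp (Complex.I * (a : ℂ))‖ = 1 := fun a => by
    rw [mul_comm]; exact Complex.norm_exp_ofReal_mul_I a
  set f : ℝ → ℂ := fun φ => F φ * Complex.exp (Complex.I * Complex.ofReal (x * Real.cos φ + y * Real.sin φ)) with hf
  have hi : IntegrableOn f (Ioc 0 (2 * π)) := by
    refine Integrable.mono' hF.norm (hF.aestronglyMeasurable.mul (by fun_prop)) (Eventually.of_forall fun φ => ?_)
    simp only [hf]
    rw [norm_mul, hn, mul_one]
  have hii : ∀ a b, 0 ≤ a → a ≤ b → b ≤ 2 * π → IntervalIntegrable f volume a b := fun a b h1 h2 h3 =>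
    (intervalIntegrable_iff_integrableOn_Ioc_of_le h2).2 (hi.mono_set (Ioc_subset_Ioc h1 h3))
  have i1 := hii 0 (π / 4) (by linarith) (by linarith) (by linarith)
  have i2 := hii (π / 4) (3 * π / 4) (by linarith) (by linarith) (by linarith)
  have i3 := hii (3 * π / 4) (5 * π / 4) (by linarith) (by linarith) (by linarith)
  have i4 := hii (5 * π / 4) (7 * π / 4) (by linarith) (by linarith) (by linarith)
  have i5 := hii (7 * π / 4) (2 * π) (by linarith) (by linarith) (by linarith)
  have e : ∀ a b, a ≤ b → Ppiece F (Ioc a b) x y = ∫ φ in a..b, f φ := fun a b h => by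
    rw [intervalIntegral.integral_of_le h]; rfl
  have e0 : Ppiece F ∅ x y = 0 := by simp [Ppiece]
  rw [e0, e _ _ (by linarith), e _ _ (by linarith), e _ _ (by linarith), e _ _ (by linarith), e _ _ (by linarith)]
  unfold Rext
  rw [← intervalIntegral.integral_add_adjacent_intervals i1 (((i2.trans i3).trans i4).trans i5),
    ← intervalIntegral.integral_add_adjacent_intervals i2 ((i3.trans i4).trans i5),
    ← intervalIntegral.integral_add_adjacent_intervals i3 (i4.trans i5),
    ← intervalIntegral.integral_add_adjacent_intervals i4 i5]
  ring

lemma aux_main (γ q u N : ℝ) (hq : 0 < q) (hu0 : 0 ≤ u) (huq : u ≤ 1 / q) (hu1 : u ≤ 1 / 2)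
    (hγ : 2 / q - u ≤ γ) (F : ℝ → ℂ) (hF : Measurable F) (hFi : IntegrableOn F (Ioc 0 (2 * π))) (hN : 0 < N)
    (hpi : IntegrableOn (fun φ => ‖F φ‖ ^ (1 / (1 - u))) (Ioc 0 (2 * π)))
    (hpN : ∫ φ in Ioc 0 (2 * π), ‖F φ‖ ^ (1 / (1 - u)) ≤ N ^ (1 / (1 - u))) :
    mixedXY q (fun p => Complex.ofReal (1 / (2 * π)) * (Ppiece F (Ioc 0 (π / 4)) p.1 p.2 +
      Ppiece F (Ioc (3 * π / 4) (5 * π / 4)) p.1 p.2 + Ppiece F (Ioc (7 * π / 4) (2 * π)) p.1 p.2) *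
        Complex.ofReal ((1 + |p.1| + |p.2|) ^ (-γ))) +
    mixedYX q (fun p => Complex.ofReal (1 / (2 * π)) * (Ppiece F (Ioc (π / 4) (3 * π / 4)) p.1 p.2 +
      Ppiece F (Ioc (5 * π / 4) (7 * π / 4)) p.1 p.2 + Ppiece F ∅ p.1 p.2) *
        Complex.ofReal ((1 + |p.1| + |p.2|) ^ (-γ)))
    ≤ ENNReal.ofReal (12 * (2 * (3 * (2 * π / (1 / π) * Real.exp 1) + 2)) ^ (1 / q) * N) := by
  have hpi0 := Real.pi_pos
  set d := 2 * π / (1 / π) * Real.exp 1 with hd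
  have hd0 : 0 < d := by positivity
  have key : ∀ (S : Set ℝ), MeasurableSet S → S ⊆ Ioc 0 (2 * π) → ∀ (ω θ : ℝ → ℝ), Measurable ω → Measurable θ →
      (∀ φ ∈ S, ∀ ψ ∈ S, 1 / π * |φ - ψ| ≤ |θ φ - θ ψ|) → ∀ τ : ℝ, 0 < τ →
      volume {y : ℝ | 2 * N * τ ^ u < ‖∫ φ in S, F φ * Complex.exp (Complex.I * (ω φ + y * θ φ : ℝ))‖}
      ≤ ENNReal.ofReal (d / τ) := by
    intro S hS hSs ω θ hω hθ hsep τ hτ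
    refine aux_K S hS ((measure_mono hSs).trans_lt (by rw [Real.volume_Ioc]; exact ENNReal.ofReal_lt_top)).ne F hF (hFi.mono_set hSs) ω θ hω hθ (1 / π) (by positivity)
      hsep u hu0 hu1 N hN (hpi.mono_set hSs) (le_trans ?_ hpN) τ hτ
    exact setIntegral_mono_set hpi (Eventually.of_forall fun φ => by positivity) (Eventually.of_forall hSs)
  have keyX : ∀ (a b : ℝ), 0 ≤ a → b ≤ 2 * π → b - a ≤ π / 2 → (∀ m ∈ Icc a b, 1 / 2 ≤ |Real.cos m|) →
      ∀ x τ : ℝ, 0 < τ → volume {y : ℝ | 2 * N * τ ^ u < ‖Ppiece F (Ioc a b) x y‖} ≤ ENNReal.ofReal (d / τ) := by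
    intro a b ha hb hab hc x τ hτ
    exact key (Ioc a b) measurableSet_Ioc (Ioc_subset_Ioc ha hb) (fun φ => x * Real.cos φ) Real.sin (by fun_prop) (by fun_prop)
      (sep_sin a b hab hc) τ hτ
  have keyY : ∀ (a b : ℝ), 0 ≤ a → b ≤ 2 * π → b - a ≤ π / 2 → (∀ m ∈ Icc a b, 1 / 2 ≤ |Real.sin m|) →
      ∀ y τ : ℝ, 0 < τ → volume {x : ℝ | 2 * N * τ ^ u < ‖Ppiece F (Ioc a b) x y‖} ≤ ENNReal.ofReal (d / τ) := by
    intro a b ha hb hab hc y τ hτ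
    have := key (Ioc a b) measurableSet_Ioc (Ioc_subset_Ioc ha hb) (fun φ => y * Real.sin φ) Real.cos (by fun_prop) (by fun_prop)
      (sep_cos a b hab hc) τ hτ
    simp_rw [add_comm (y * _)] at this
    exact this
  have key0 : ∀ y τ : ℝ, 0 < τ → volume {x : ℝ | 2 * N * τ ^ u < ‖Ppiece F ∅ x y‖} ≤ ENNReal.ofReal (d / τ) := by
    intro y τ hτ
    have : {x : ℝ | 2 * N * τ ^ u < ‖Ppiece F ∅ x y‖} = ∅ := by
      ext x
      simp only [mem_ofPred_eq, mem_empty_iff_false, iff_false, not_lt, Ppiece, Measure.restrict_empty,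
        integral_zero_measure, norm_zero]
      positivity
    rw [this]; simp
  have hX := aux_mixed q u γ (3 * (2 * N)) (3 * d) hq huq hγ (by positivity) (by positivity)
    (fun x y => Complex.ofReal (1 / (2 * π)) * (Ppiece F (Ioc 0 (π / 4)) x y +
      Ppiece F (Ioc (3 * π / 4) (5 * π / 4)) x y + Ppiece F (Ioc (7 * π / 4) (2 * π)) x y))
    (fun x y => Complex.ofReal ((1 + |x| + |y|) ^ (-γ)))
    (fun x y => by rw [Complex.norm_real, Real.norm_of_nonneg (by positivity)])
    (fun x τ hτ => by
      have := aux_three (Ppiece F (Ioc 0 (π / 4)) x) (Ppiece F (Ioc (3 * π / 4) (5 * π / 4)) x)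
        (Ppiece F (Ioc (7 * π / 4) (2 * π)) x) (2 * N * τ ^ u) (d / τ) (by positivity)
        (keyX _ _ le_rfl (by linarith) (by linarith) (fun m hm => by
          exact (cos_half m (by linarith [hm.1]) (by linarith [hm.2])).trans (le_abs_self _)) x τ hτ)
        (keyX _ _ (by linarith) (by linarith) (by linarith) (fun m hm => by
          have := cos_half (m - π) (by linarith [hm.1]) (by linarith [hm.2])
          rw [Real.cos_sub_pi] at this
          exact this.trans (neg_le_abs _)) x τ hτ)
        (keyX _ _ (by linarith) (by linarith) (by linarith) (fun m hm => by
          have := cos_half (m - 2 * π) (by linarith [hm.1]) (by linarith [hm.2])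
          rw [Real.cos_sub_two_pi] at this
          exact this.trans (le_abs_self _)) x τ hτ)
      rw [show 3 * (2 * N) * τ ^ u = 3 * (2 * N * τ ^ u) by ring, show 3 * d / τ = 3 * (d / τ) by ring]
      exact this)
  have hY := aux_mixed q u γ (3 * (2 * N)) (3 * d) hq huq hγ (by positivity) (by positivity)
    (fun y x => Complex.ofReal (1 / (2 * π)) * (Ppiece F (Ioc (π / 4) (3 * π / 4)) x y +
      Ppiece F (Ioc (5 * π / 4) (7 * π / 4)) x y + Ppiece F ∅ x y))
    (fun y x => Complex.ofReal ((1 + |x| + |y|) ^ (-γ)))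
    (fun y x => by rw [Complex.norm_real, Real.norm_of_nonneg (by positivity), add_right_comm])
    (fun y τ hτ => by
      have := aux_three (fun x => Ppiece F (Ioc (π / 4) (3 * π / 4)) x y)
        (fun x => Ppiece F (Ioc (5 * π / 4) (7 * π / 4)) x y)
        (fun x => Ppiece F ∅ x y) (2 * N * τ ^ u) (d / τ) (by positivity)
        (keyY _ _ (by linarith) (by linarith) (by linarith) (fun m hm => by
          have := cos_half (m - π / 2) (by linarith [hm.1]) (by linarith [hm.2])
          rw [Real.cos_sub_pi_div_two] at this
          exact this.trans (le_abs_self _)) y τ hτ)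
        (keyY _ _ (by linarith) (by linarith) (by linarith) (fun m hm => by
          have := cos_half (m - π - π / 2) (by linarith [hm.1]) (by linarith [hm.2])
          rw [Real.cos_sub_pi_div_two, Real.sin_sub_pi] at this
          exact this.trans (neg_le_abs _)) y τ hτ)
        (key0 y τ hτ)
      rw [show 3 * (2 * N) * τ ^ u = 3 * (2 * N * τ ^ u) by ring, show 3 * d / τ = 3 * (d / τ) by ring]
      exact this)
  refine (add_le_add hX hY).trans (le_of_eq ?_)
  rw [← ENNReal.ofReal_add (by positivity) (by positivity)]
  congr 1
  ring

/-- Lemma 16: mixed weak-type bound for `R*_γ` into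
`L^{q,∞}_x(L^{q,∞}_y) + L^{q,∞}_y(L^{q,∞}_x)`. -/
theorem statement13 (γ q : ℝ) (hγ : 0 ≤ γ) (hq : 0 < q)
    (r : ℝ≥0∞) (hr : 1 ≤ r)
    (hcond : γ ≥ max (1 / q) (max (2 / q - (1 - r⁻¹.toReal)) (2 / q - 1 / 2))) :
    ∃ C : ℝ, 0 < C ∧ ∀ F : ℝ → ℂ, Measurable F →
      ∃ g₁ g₂ : ℝ × ℝ → ℂ, Measurable g₁ ∧ Measurable g₂ ∧
        (∀ᵐ p : ℝ × ℝ, Rgamma γ F p.1 p.2 = g₁ p + g₂ p) ∧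
        mixedXY q g₁ + mixedYX q g₂ ≤ ENNReal.ofReal C * circleLp r F := by
  have hpi0 := Real.pi_pos
  have hri : r⁻¹ ≤ 1 := ENNReal.inv_le_one.2 hr
  have hrt : r⁻¹ ≠ ⊤ := (hri.trans_lt ENNReal.one_lt_top).ne
  have hrr : r⁻¹.toReal ≤ 1 := by
    have := ENNReal.toReal_mono ENNReal.one_ne_top hri
    simpa using this
  set u := min (1 / q) (min (1 - r⁻¹.toReal) (1 / 2)) with hu
  have hqi : 0 < 1 / q := by positivity
  have hu0 : 0 ≤ u := le_min hqi.le (le_min (by linarith) (by norm_num))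
  have huq : u ≤ 1 / q := min_le_left _ _
  have hur : u ≤ 1 - r⁻¹.toReal := (min_le_right _ _).trans (min_le_left _ _)
  have hu1 : u ≤ 1 / 2 := (min_le_right _ _).trans (min_le_right _ _)
  have hγu : 2 / q - u ≤ γ := by
    have c1 := (le_max_left _ _).trans hcond
    have c2 := ((le_max_left _ _).trans (le_max_right _ _)).trans hcond
    have c3 := ((le_max_right _ _).trans (le_max_right _ _)).trans hcond
    have : 2 / q = 1 / q + 1 / q := by ring
    rcases min_choice (1 / q) (min (1 - r⁻¹.toReal) (1 / 2)) with h | h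
    · rw [hu, h]; linarith
    · rcases min_choice (1 - r⁻¹.toReal) (1 / 2) with h' | h' <;> rw [hu, h, h'] <;> linarith
  have h1u : 0 < 1 - u := by linarith
  set p : ℝ≥0∞ := ENNReal.ofReal (1 / (1 - u)) with hp
  have hpt : p.toReal = 1 / (1 - u) := ENNReal.toReal_ofReal (by positivity)
  have hptop : p ≠ ⊤ := ENNReal.ofReal_ne_top
  have hp1 : 1 ≤ p := by
    rw [hp, ENNReal.one_le_ofReal, le_div_iff₀ h1u]; linarith
  have hp0 : p ≠ 0 := (zero_lt_one.trans_le hp1).ne'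
  have hpr : p ≤ r := by
    rw [← ENNReal.inv_le_inv, hp, one_div, ENNReal.ofReal_inv_of_pos h1u, inv_inv,
      ENNReal.le_ofReal_iff_toReal_le hrt h1u.le]
    linarith
  set μ := volume.restrict (Ioc (0:ℝ) (2 * π)) with hμ
  have hfm : IsFiniteMeasure μ := ⟨by rw [hμ, Measure.restrict_apply_univ, Real.volume_Ioc]; exact ENNReal.ofReal_lt_top⟩
  set K : ℝ≥0∞ := μ univ ^ (1 / p.toReal - 1 / r.toReal) with hK
  have hKt : K ≠ ⊤ := by
    have h0 : μ univ ≠ 0 := by simp [hμ, hpi0]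
    exact ENNReal.rpow_ne_top_of_ne_zero h0 (measure_ne_top _ _)
  set C₁ : ℝ := 12 * (2 * (3 * (2 * π / (1 / π) * Real.exp 1) + 2)) ^ (1 / q) with hC₁
  have hC₁0 : 0 < C₁ := by positivity
  have hK0 : 0 ≤ K.toReal := ENNReal.toReal_nonneg
  refine ⟨C₁ * (K.toReal + 1), by positivity, fun F hF => ?_⟩
  have hwm : Measurable fun p : ℝ × ℝ => Complex.ofReal ((1 + |p.1| + |p.2|) ^ (-γ)) := by
    have : Measurable fun p : ℝ × ℝ => (1 + |p.1| + |p.2|) := by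
      have := (_root_.continuous_abs : Continuous fun x : ℝ => |x|).measurable
      fun_prop
    exact Complex.measurable_ofReal.comp (this.pow_const _)
  by_cases htop : circleLp r F = ⊤
  · refine ⟨fun p => Rgamma γ F p.1 p.2, fun _ => 0, ?_, measurable_const, by simp, ?_⟩
    · have : (fun p : ℝ × ℝ => Rgamma γ F p.1 p.2) = fun p : ℝ × ℝ =>
        (Complex.ofReal (1 / (2 * π)) * Ppiece F (Ioc 0 (2 * π)) p.1 p.2) * Complex.ofReal ((1 + |p.1| + |p.2|) ^ (-γ)) := by
        ext p
        rw [Rgamma, Rext, intervalIntegral.integral_of_le (by linarith)]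
        rfl
      rw [this]
      exact ((Ppiece_meas F hF _).const_mul _).mul hwm
    · rw [htop, ENNReal.mul_top (by simpa using (by positivity : 0 < C₁ * (K.toReal + 1)))]
      exact le_top
  have hmr : MemLp F r μ := ⟨hF.aestronglyMeasurable, lt_top_iff_ne_top.2 htop⟩
  have hmp : MemLp F p μ := hmr.mono_exponent hpr
  have hFi : IntegrableOn F (Ioc 0 (2 * π)) := hmp.integrable hp1
  have hpi : IntegrableOn (fun φ => ‖F φ‖ ^ (1 / (1 - u))) (Ioc 0 (2 * π)) := by
    have := hmp.integrable_norm_rpow hp0 hptop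
    rwa [hpt] at this
  set L := (circleLp r F).toReal with hL
  have hL0 : 0 ≤ L := ENNReal.toReal_nonneg
  have hle : eLpNorm F p μ ≤ ENNReal.ofReal (K.toReal * L) := by
    refine (eLpNorm_le_eLpNorm_mul_rpow_measure_univ hpr hF.aestronglyMeasurable).trans (le_of_eq ?_)
    rw [mul_comm K.toReal, ENNReal.ofReal_mul hL0, ENNReal.ofReal_toReal hKt, ENNReal.ofReal_toReal htop]
    rfl
  rw [hmp.eLpNorm_eq_integral_rpow_norm hp0 hptop, hpt] at hle
  have hle2 := (ENNReal.ofReal_le_ofReal_iff (by positivity)).1 hle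
  refine ⟨(fun p => Complex.ofReal (1 / (2 * π)) * (Ppiece F (Ioc 0 (π / 4)) p.1 p.2 +
      Ppiece F (Ioc (3 * π / 4) (5 * π / 4)) p.1 p.2 + Ppiece F (Ioc (7 * π / 4) (2 * π)) p.1 p.2) *
        Complex.ofReal ((1 + |p.1| + |p.2|) ^ (-γ))),
    (fun p => Complex.ofReal (1 / (2 * π)) * (Ppiece F (Ioc (π / 4) (3 * π / 4)) p.1 p.2 +
      Ppiece F (Ioc (5 * π / 4) (7 * π / 4)) p.1 p.2 + Ppiece F ∅ p.1 p.2) *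
        Complex.ofReal ((1 + |p.1| + |p.2|) ^ (-γ))), ?_, ?_, ?_, ?_⟩
  rotate_left 3
  · have hb := fun (ε : ℝ) (hε : 0 < ε) =>
      aux_main γ q u (K.toReal * L + ε) hq hu0 huq hu1 hγu F hF hFi (by positivity) hpi (by
        have h3 : 0 ≤ ∫ φ in Ioc 0 (2 * π), ‖F φ‖ ^ (1 / (1 - u)) := integral_nonneg fun φ => by positivity
        have h4 : (∫ φ in Ioc 0 (2 * π), ‖F φ‖ ^ (1 / (1 - u))) ^ (1 / (1 - u))⁻¹ ≤ K.toReal * L + ε :=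
          hle2.trans (by linarith)
        calc _ = ((∫ φ in Ioc 0 (2 * π), ‖F φ‖ ^ (1 / (1 - u))) ^ (1 / (1 - u))⁻¹) ^ (1 / (1 - u)) := by
              rw [← Real.rpow_mul h3, inv_mul_cancel₀ (by positivity), Real.rpow_one]
          _ ≤ _ := by gcongr)
    have ht : Tendsto (fun ε : ℝ => ENNReal.ofReal (C₁ * (K.toReal * L + ε))) (nhdsWithin 0 (Ioi 0))
        (nhds (ENNReal.ofReal (C₁ * (K.toReal * L + 0)))) := by
      refine Tendsto.mono_left (Continuous.tendsto ?_ 0) nhdsWithin_le_nhds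
      exact ENNReal.continuous_ofReal.comp (by fun_prop)
    refine (ge_of_tendsto ht (eventually_nhdsWithin_of_forall fun ε hε => hb ε hε)).trans ?_
    rw [← ENNReal.ofReal_toReal htop, ← ENNReal.ofReal_mul (by positivity)]
    apply ENNReal.ofReal_le_ofReal
    rw [← hL]
    nlinarith [mul_nonneg hC₁0.le hL0]
  · exact ((((Ppiece_meas F hF _).add (Ppiece_meas F hF _)).add (Ppiece_meas F hF _)).const_mul _).mul hwm
  · exact ((((Ppiece_meas F hF _).add (Ppiece_meas F hF _)).add (Ppiece_meas F hF _)).const_mul _).mul hwm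
  · refine Eventually.of_forall fun p => ?_
    simp only
    rw [Rgamma, Rext_split F hFi, add_mul]
end
end
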